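/- arXiv:2002.11709 — 3 statements merged into one kernel-verified Lean document; each statement's English description precedes it below -/
import Mathlib

section
/- Let k be an uncountable algebraically closed field of characteristic zero, and let X be a variety over k that is geometrically hyperbolic over k (i.e., for every smooth integral curve C over k, every c ∈ C(k) and every x ∈ X(k), the set of morphisms f: C → X with f(c) = x is finite). Then for every integral variety Y over k, every y ∈ Y(k), and every x ∈ X(k), the set of morphisms f: Y → X with f(y) = x is finite. -/
/-- In a Noetherian domain containing an uncountable field, a prime of height at least two strictly
contains a nonzero prime avoiding countably many nonzero ideals. -/
theorem exists_prime_lt_forall_not_le {k A ι : Type*} [Field k] [Uncountable k] [CommRing A]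
    [IsDomain A] [IsNoetherianRing A] [Algebra k A] [Countable ι] (I : ι → Ideal A)
    (hI : ∀ i, I i ≠ ⊥) (q m : Ideal A) [q.IsPrime] [m.IsPrime] (hq : ⊥ < q) (hqm : q < m) :
    ∃ p : Ideal A, p.IsPrime ∧ ⊥ < p ∧ p < m ∧ ∀ i, ¬ I i ≤ p := by
  have key : ∀ P₀ P : Ideal A, P₀.IsPrime → P.IsPrime → ⊥ < P₀ → P₀ < P → ¬ P.height ≤ 1 := by
    intro P₀ P h₀ hP h1 h2 hle
    have e1 := Ideal.height_strict_mono_of_isPrime_of_isPrime (I := ⊥) (J := P₀) h1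
    have e2 := Ideal.height_strict_mono_of_isPrime_of_isPrime (I := P₀) (J := P) h2
    have e3 : P₀.height < 1 := e2.trans_le hle
    rw [Order.lt_one_iff] at e3
    simp [e3] at e1
  have hm : ¬ m.height ≤ 1 := key q m ‹_› ‹_› hq hqm
  obtain ⟨a, ham, ha0⟩ := Submodule.exists_mem_ne_zero_of_ne_bot (hq.trans hqm).ne'
  have hb : ∃ b ∈ m, ∀ P ∈ (Ideal.span {a}).minimalPrimes, b ∉ P := by
    by_contra! h
    obtain ⟨P, hP, hmP⟩ := (m.subset_union_prime_finite
      (Ideal.finite_minimalPrimes_of_isNoetherianRing A (Ideal.span {a})) (f := id) ⊥ ⊥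
      fun P hP _ _ ↦ hP.1.1).1 (fun b hb ↦ by simpa using h b hb)
    exact hm ((Ideal.height_mono hmP).trans
      (Ideal.height_le_one_of_isPrincipal_of_mem_minimalPrimes _ _ hP))
  obtain ⟨b, hbm, hb⟩ := hb
  have hpr (t : k) : ∃ P ∈ (Ideal.span {a - algebraMap k A t * b}).minimalPrimes, P ≤ m :=
    Ideal.exists_minimalPrimes_le ((Ideal.span_singleton_le_iff_mem _).2
      (m.sub_mem ham (m.mul_mem_left _ hbm)))
  choose p hp hpm using hpr
  have hpp (t : k) : (p t).IsPrime := (hp t).1.1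
  have hmem (t : k) : a - algebraMap k A t * b ∈ p t :=
    (Ideal.span_singleton_le_iff_mem _).1 (hp t).1.2
  have hht (t : k) : (p t).height ≤ 1 :=
    Ideal.height_le_one_of_isPrincipal_of_mem_minimalPrimes _ _ (hp t)
  have hlt (t : k) : p t < m := (hpm t).lt_of_ne fun h ↦ hm (h ▸ hht t)
  have hab (P : Ideal A) (hP : P.IsPrime) (hPa : a ∈ P) (hPb : b ∈ P) : ¬ P.height ≤ 1 := by
    obtain ⟨P₀, h₀, h₀P⟩ := Ideal.exists_minimalPrimes_le
      ((Ideal.span_singleton_le_iff_mem _).2 hPa)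
    refine key P₀ P h₀.1.1 hP (bot_lt_iff_ne_bot.2 ?_) (h₀P.lt_of_ne ?_)
    · rintro rfl
      exact ha0 (by simpa using h₀.1.2)
    · rintro rfl
      exact hb _ h₀ hPb
  have hbot (t : k) : ⊥ < p t := by
    refine bot_lt_iff_ne_bot.2 fun h ↦ ?_
    have h1 := hmem t
    rw [h, Ideal.mem_bot, sub_eq_zero] at h1
    obtain ⟨P₀, h₀, -⟩ := Ideal.exists_minimalPrimes_le
      ((Ideal.span_singleton_le_iff_mem _).2 ham)
    have h2 : a ∈ P₀ := (Ideal.span_singleton_le_iff_mem _).1 h₀.1.2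
    have ht : t ≠ 0 := by
      rintro rfl
      simp [ha0] at h1
    refine hb P₀ h₀ ?_
    have : b = algebraMap k A t⁻¹ * a := by
      rw [h1, ← mul_assoc, ← map_mul, inv_mul_cancel₀ ht, map_one, one_mul]
    rw [this]
    exact P₀.mul_mem_left _ h2
  have hinj : Function.Injective p := by
    intro s t hst
    by_contra hne
    have h1 : algebraMap k A (t - s) * b ∈ p t := by
      have := (p t).sub_mem (hst ▸ hmem s) (hmem t)
      rwa [show a - algebraMap k A s * b - (a - algebraMap k A t * b) =
        algebraMap k A (t - s) * b by rw [map_sub]; ring] at this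
    have h2 : b ∈ p t := by
      have := (p t).mul_mem_left (algebraMap k A (t - s)⁻¹) h1
      rwa [← mul_assoc, ← map_mul, inv_mul_cancel₀ (sub_ne_zero.2 (Ne.symm hne)), map_one,
        one_mul] at this
    have h3 : a ∈ p t := by
      simpa using (p t).add_mem (hmem t) ((p t).mul_mem_left (algebraMap k A t) h2)
    exact hab _ (hpp t) h3 h2 (hht t)
  by_contra! hbad
  have hsub : Set.range p ⊆ ⋃ i, (I i).minimalPrimes := by
    rintro _ ⟨t, rfl⟩
    obtain ⟨i, hi⟩ := hbad (p t) (hpp t) (hbot t) (hlt t)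
    obtain ⟨P, hP, hPt⟩ := Ideal.exists_minimalPrimes_le hi
    refine Set.mem_iUnion.2 ⟨i, ?_⟩
    rcases hPt.eq_or_lt with h | h
    · exact h ▸ hP
    · refine absurd (hht t) (key P _ hP.1.1 (hpp t) (bot_lt_iff_ne_bot.2 ?_) h)
      rintro rfl
      exact hI i (le_bot_iff.1 hP.1.2)
  have hc : (Set.range p).Countable := (Set.countable_iUnion fun i ↦
    (Ideal.finite_minimalPrimes_of_isNoetherianRing A (I i)).countable).mono hsub
  have : Countable k := by
    have := hc.to_subtype
    exact (Equiv.ofInjective p hinj).countable_iff.2 this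
  exact not_countable this

/-- In a Noetherian domain containing an uncountable field, below a nonzero prime `m` there is a
prime of coheight one in `m` which avoids countably many nonzero ideals. -/
theorem exists_prime_covBy_forall_not_le {k A ι : Type*} [Field k] [Uncountable k] [CommRing A]
    [IsDomain A] [IsNoetherianRing A] [Algebra k A] [Countable ι] (I : ι → Ideal A)
    (hI : ∀ i, I i ≠ ⊥) (m : Ideal A) [m.IsPrime] (hm : ⊥ < m) :
    ∃ p : Ideal A, p.IsPrime ∧ p < m ∧ (∀ i, ¬ I i ≤ p) ∧
      ∀ q : Ideal A, q.IsPrime → p < q → q ≤ m → q = m := by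
  obtain ⟨p, ⟨hp, hpm, hpI⟩, hmax⟩ := set_has_maximal_iff_noetherian.2 ‹IsNoetherianRing A›
    {p : Ideal A | p.IsPrime ∧ p < m ∧ ∀ i, ¬ I i ≤ p}
    ⟨⊥, Ideal.isPrime_bot, hm, fun i h ↦ hI i (le_bot_iff.1 h)⟩
  refine ⟨p, hp, hpm, hpI, fun q hq hpq hqm ↦ ?_⟩
  by_contra hne
  let π := Ideal.Quotient.mk p
  have hπ : Function.Surjective π := Ideal.Quotient.mk_surjective
  have hker : RingHom.ker π = p := Ideal.mk_ker
  have hcm (J : Ideal A) (hJ : p ≤ J) : (J.map π).comap π = J := by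
    rw [Ideal.comap_map_of_surjective π hπ, ← RingHom.ker_eq_comap_bot, hker, sup_eq_left.2 hJ]
  have hprime (J : Ideal A) (hJ : J.IsPrime) (hpJ : p ≤ J) : (J.map π).IsPrime :=
    Ideal.map_isPrime_of_surjective hπ (hker.trans_le hpJ)
  have hlt (J K : Ideal A) (hJ : p ≤ J) (hK : p ≤ K) (h : J < K) : J.map π < K.map π :=
    (Ideal.map_mono h.le).lt_of_ne fun e ↦ h.ne (by rw [← hcm J hJ, e, hcm K hK])
  have := hprime q hq hpq.le
  have := hprime m ‹_› hpm.le
  obtain ⟨P, hP, hP0, hPm, hPI⟩ := exists_prime_lt_forall_not_le (k := k) (fun i ↦ (I i).map π)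
    (fun i h ↦ hpI i ((Ideal.map_eq_bot_iff_le_ker π).1 h |>.trans_eq hker)) (q.map π) (m.map π)
    (by simpa [π, Ideal.map_quotient_self] using hlt p q le_rfl hpq.le hpq)
    (hlt q m hpq.le hpm.le (hqm.lt_of_ne hne))
  have hcomap : ∀ J K : Ideal (A ⧸ p), J < K → J.comap π < K.comap π := fun J K h ↦
    (Ideal.comap_mono h.le).lt_of_ne fun e ↦
      h.ne (Ideal.comap_injective_of_surjective π hπ e)
  refine hmax (P.comap π) ⟨inferInstance, ?_, fun i h ↦ hPI i (Ideal.map_le_iff_le_comap.2 h)⟩ ?_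
  · simpa [hcm m hpm.le] using hcomap _ _ hPm
  · simpa [← RingHom.ker_eq_comap_bot, hker] using hcomap _ _ hP0

/-- A polynomial ring in finitely many variables is standard smooth of relative dimension the number
of variables. -/
theorem MvPolynomial.isStandardSmoothOfRelativeDimension (R ι : Type) [CommRing R] [Finite ι] :
    Algebra.IsStandardSmoothOfRelativeDimension (Nat.card ι) R (MvPolynomial ι R) := by
  let P : Algebra.SubmersivePresentation R (MvPolynomial ι R) ι PEmpty.{1} :=
    { Algebra.Generators.mvPolynomial R ι with
      relation := PEmpty.elim
      span_range_relation_eq_ker := by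
        rw [Algebra.Generators.ker_eq_ker_aeval_val, Set.range_eq_empty, Ideal.span_empty]
        refine ((RingHom.injective_iff_ker_eq_bot _).1 fun x y h ↦ ?_).symm
        simpa [Algebra.Generators.mvPolynomial] using h
      map := PEmpty.elim
      map_inj := fun a ↦ a.elim
      jacobian_isUnit := by
        rw [Algebra.PreSubmersivePresentation.jacobian_eq_jacobiMatrix_det]
        simp }
  exact P.isStandardSmoothOfRelativeDimension (by simp [Algebra.Presentation.dimension])

open Polynomial in
theorem Polynomial.isStandardSmoothOfRelativeDimension (R : Type) [CommRing R] :
    Algebra.IsStandardSmoothOfRelativeDimension 1 R R[X] := by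
  have := MvPolynomial.isStandardSmoothOfRelativeDimension R PUnit
  simpa using Algebra.IsStandardSmoothOfRelativeDimension.of_algEquiv
    (n := Nat.card PUnit) (MvPolynomial.uniqueAlgEquiv R PUnit)

/-- Nullstellensatz: the residue fields of a finite type algebra over an algebraically closed field
at maximal ideals are the base field. -/
theorem Ideal.IsMaximal.algebraMap_quotient_bijective {k C : Type*} [Field k] [IsAlgClosed k]
    [CommRing C] [Algebra k C] [Algebra.FiniteType k C] (n : Ideal C) [n.IsMaximal] :
    Function.Bijective (algebraMap k (C ⧸ n)) := by
  let := Ideal.Quotient.field n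
  have := finite_of_finite_type_of_isJacobsonRing k (C ⧸ n)
  exact IsAlgClosed.algebraMap_bijective_of_isIntegral

/-- Nullstellensatz: every maximal ideal of a finite type algebra over an algebraically closed field
is the kernel of a point with values in the base field. -/
theorem Ideal.IsMaximal.exists_algHom_ker_eq {k C : Type*} [Field k] [IsAlgClosed k]
    [CommRing C] [Algebra k C] [Algebra.FiniteType k C] (n : Ideal C) [n.IsMaximal] :
    ∃ ψ : C →ₐ[k] k, RingHom.ker ψ = n := by
  let e := AlgEquiv.ofBijective (Algebra.ofId k (C ⧸ n))
    (Ideal.IsMaximal.algebraMap_quotient_bijective n)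
  refine ⟨(e.symm : (C ⧸ n) →ₐ[k] k).comp (Ideal.Quotient.mkₐ k n), ?_⟩
  ext x
  simp [RingHom.mem_ker, Ideal.Quotient.eq_zero_iff_mem]

open Polynomial in
/-- A finite type domain over an algebraically closed field is smooth of relative dimension one near
a nonzero maximal ideal at which its localization is a discrete valuation ring: a uniformizer defines
a map to the affine line which is étale there. -/
theorem exists_isStandardSmooth_of_isPrincipal {k S : Type} [Field k]
    [IsAlgClosed k] [CommRing S] [IsDomain S] [Algebra k S] [Algebra.FiniteType k S]
    (n : Ideal S) [n.IsMaximal] (hn : n ≠ ⊥)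
    (hprin : (IsLocalRing.maximalIdeal (Localization.AtPrime n)).IsPrincipal) :
    ∃ g ∉ n, Algebra.IsStandardSmoothOfRelativeDimension 1 k (Localization.Away g) := by
  have hmap := IsLocalization.AtPrime.map_eq_maximalIdeal n (Localization.AtPrime n)
  obtain ⟨t, htn, ht⟩ : ∃ t ∈ n,
      Ideal.span {algebraMap S (Localization.AtPrime n) t} = IsLocalRing.maximalIdeal _ := by
    obtain ⟨x, hx⟩ := hprin
    obtain ⟨t, s, rfl⟩ := IsLocalization.exists_mk'_eq n.primeCompl x
    have hsp : Ideal.span {algebraMap S (Localization.AtPrime n) t} =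
        IsLocalRing.maximalIdeal _ := by
      rw [hx, ← Ideal.submodule_span_eq, Submodule.span, Submodule.span]
      change Ideal.span _ = Ideal.span _
      rw [Ideal.span_singleton_eq_span_singleton]
      refine ⟨(IsLocalization.map_units (Localization.AtPrime n) s).unit⁻¹, ?_⟩
      rw [Units.mul_inv_eq_iff_eq_mul]
      simp
    refine ⟨t, ?_, hsp⟩
    have : algebraMap S (Localization.AtPrime n) t ∈ IsLocalRing.maximalIdeal _ :=
      hsp ▸ Ideal.mem_span_singleton_self _
    exact (IsLocalization.AtPrime.to_map_mem_maximal_iff _ n t).1 this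
  have ht0 : t ≠ 0 := by
    rintro rfl
    rw [map_zero, Ideal.span_singleton_zero, ← hmap, eq_comm, Ideal.map_eq_bot_iff_of_injective
      (IsLocalization.injective _ n.primeCompl_le_nonZeroDivisors)] at ht
    exact hn ht
  let : Algebra k[X] S := (aeval t).toAlgebra
  have halg : ∀ f : k[X], algebraMap k[X] S f = aeval t f := fun f ↦ rfl
  have : IsScalarTower k k[X] S := IsScalarTower.of_algebraMap_eq fun r ↦ by simp [halg]
  have : Algebra.FiniteType k[X] S := .of_restrictScalars_finiteType k k[X] S
  have : Algebra.FinitePresentation k[X] S := Algebra.FinitePresentation.of_finiteType.1 this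
  let p : Ideal k[X] := Ideal.span {X}
  have hpmax : p.IsMaximal :=
    PrincipalIdealRing.isMaximal_of_irreducible Polynomial.irreducible_X
  have hcomap (q : Ideal S) (hq : q ≠ ⊤) (htq : t ∈ q) : q.comap (algebraMap k[X] S) = p :=
    (hpmax.eq_of_le (Ideal.comap_ne_top _ hq) ((Ideal.span_singleton_le_iff_mem _).2
      (by simpa [halg] using htq))).symm
  have hinj : Function.Injective (algebraMap k[X] S) := by
    rw [RingHom.injective_iff_ker_eq_bot]
    by_contra hbot
    have := RingHom.ker_isPrime (algebraMap k[X] S)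
    have := IsPrime.to_maximal_ideal hbot
    have h1 := hcomap n Ideal.IsPrime.ne_top' htn
    have h2 : RingHom.ker (algebraMap k[X] S) = p := by
      rw [← h1]
      exact this.eq_of_le (h1 ▸ hpmax.ne_top) (Ideal.ker_le_comap _)
    have h3 : (X : k[X]) ∈ RingHom.ker (algebraMap k[X] S) :=
      h2 ▸ Ideal.mem_span_singleton_self _
    exact ht0 (by simpa [halg] using h3)
  have : Module.IsTorsionFree k[X] S :=
    Module.isTorsionFree_iff_algebraMap_injective.2 hinj
  have : n.LiesOver p := ⟨(hcomap n Ideal.IsPrime.ne_top' htn).symm⟩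
  let := Localization.AtPrime.algebraOfLiesOver p n
  have hsep : Algebra.IsSeparable p.ResidueField n.ResidueField := by
    refine ⟨fun x ↦ ?_⟩
    obtain ⟨c, rfl⟩ := n.algebraMap_residueField_surjective x
    obtain ⟨r, hr⟩ := (Ideal.IsMaximal.algebraMap_quotient_bijective (k := k) n).2
      (Ideal.Quotient.mk n c)
    have hrc : algebraMap S n.ResidueField c =
        algebraMap p.ResidueField n.ResidueField (algebraMap k[X] p.ResidueField (C r)) := by
      rw [← IsScalarTower.algebraMap_apply, IsScalarTower.algebraMap_apply k[X] S n.ResidueField,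
        halg, aeval_C, eq_comm, ← sub_eq_zero, ← map_sub, Ideal.algebraMap_residueField_eq_zero,
        ← Ideal.Quotient.mk_eq_mk_iff_sub_mem, ← hr]
      rfl
    rw [hrc]
    exact isSeparable_algebraMap _
  have : Algebra.IsUnramifiedAt k[X] n := by
    refine (Algebra.isUnramifiedAt_iff_map_eq k[X] p n).2 ⟨hsep, ?_⟩
    rw [Ideal.map_span, Set.image_singleton,
      IsScalarTower.algebraMap_apply k[X] S (Localization.AtPrime n), halg, aeval_X, ht]
  have := Algebra.IsEtaleAt.of_isUnramifiedAt_of_flat (R := k[X]) n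
  obtain ⟨g, hg, hgE⟩ := Algebra.exists_etale_of_isEtaleAt (R := k[X]) n
  have := Algebra.Etale.iff_isStandardSmoothOfRelativeDimension_zero.1 hgE
  have := Polynomial.isStandardSmoothOfRelativeDimension k
  exact ⟨g, hg, Algebra.IsStandardSmoothOfRelativeDimension.trans 1 0 k k[X] _⟩

/-- In characteristic zero, the normalization of a finite type domain is finite. -/
theorem integralClosure_finite_of_finiteType (k B L : Type*) [Field k] [CharZero k] [CommRing B]
    [IsDomain B] [Algebra k B] [Algebra.FiniteType k B] [Field L] [Algebra B L]
    [IsFractionRing B L] : Module.Finite B (integralClosure B L) := by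
  obtain ⟨s, φ, hinj, hfin⟩ := exists_finite_inj_algHom_of_fg k B
  let P := MvPolynomial (Fin s) k
  let : Algebra P B := φ.toRingHom.toAlgebra
  have : Module.Finite P B := hfin
  let : Algebra P L := ((algebraMap B L).comp (algebraMap P B)).toAlgebra
  have : IsScalarTower P B L := .of_algebraMap_eq fun _ ↦ rfl
  have hPL : Function.Injective (algebraMap P L) :=
    (IsFractionRing.injective B L).comp hinj
  have : FaithfulSMul P B := (faithfulSMul_iff_algebraMap_injective P B).2 hinj
  have : FaithfulSMul P L := (faithfulSMul_iff_algebraMap_injective P L).2 hPL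
  let K := FractionRing P
  let : Algebra K L := FractionRing.liftAlgebra P L
  have : IsScalarTower P K L := FractionRing.isScalarTower_liftAlgebra P L
  have : Algebra.IsIntegral P B := Algebra.IsIntegral.of_finite P B
  have : Algebra.IsAlgebraic P B := Algebra.IsIntegral.isAlgebraic
  have : IsLocalization (Algebra.algebraMapSubmonoid B (nonZeroDivisors P)) L := by
    infer_instance
  have : FiniteDimensional K L := .of_isLocalization P B (nonZeroDivisors P)
  have : CharZero P := charZero_of_injective_algebraMap (MvPolynomial.C_injective (Fin s) k)
  have : CharZero K := charZero_of_injective_algebraMap (IsFractionRing.injective P K)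
  have : IsIntegralClosure (integralClosure B L) P L :=
    { algebraMap_injective := Subtype.val_injective
      isIntegral_iff := fun {x} ↦
        ⟨fun hx ↦ ⟨⟨x, hx.tower_top⟩, rfl⟩, fun ⟨y, hy⟩ ↦ hy ▸ isIntegral_trans _ y.2⟩ }
  have : IsScalarTower P B (integralClosure B L) := inferInstance
  have := IsIntegralClosure.finite P K L (integralClosure B L)
  exact Module.Finite.of_restrictScalars_finite P B _

/-- The localization of a normal Noetherian domain at a prime of height at most one has principal
maximal ideal. -/
theorem isPrincipal_maximalIdeal_localization_atPrime {C : Type*} [CommRing C] [IsDomain C]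
    [IsNoetherianRing C] [IsIntegrallyClosed C] (n : Ideal C) [n.IsPrime]
    (h : ∀ q : Ideal C, q.IsPrime → q ≤ n → q ≠ ⊥ → q = n) :
    (IsLocalRing.maximalIdeal (Localization.AtPrime n)).IsPrincipal := by
  have := IsLocalization.isNoetherianRing n.primeCompl (Localization.AtPrime n) ‹_›
  have := isIntegrallyClosed_of_isLocalization (Localization.AtPrime n) n.primeCompl
    n.primeCompl_le_nonZeroDivisors
  have key : (IsIntegrallyClosed (Localization.AtPrime n) ∧
      ∀ P : Ideal (Localization.AtPrime n), P ≠ ⊥ → P.IsPrime → P = IsLocalRing.maximalIdeal _) ↔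
      (IsLocalRing.maximalIdeal (Localization.AtPrime n)).IsPrincipal :=
    (tfae_of_isNoetherianRing_of_isLocalRing_of_isDomain (Localization.AtPrime n)).out 3 4
  refine key.1 ⟨this, fun P hP hPp ↦ ?_⟩
  have hle := IsLocalRing.le_maximalIdeal hPp.ne_top
  have hcomap : (IsLocalRing.maximalIdeal (Localization.AtPrime n)).comap (algebraMap C _) = n :=
    IsLocalization.AtPrime.under_maximalIdeal (Localization.AtPrime n) n
  have hinj : Function.Injective (Ideal.comap (algebraMap C (Localization.AtPrime n))) :=
    (IsLocalization.orderEmbedding n.primeCompl (Localization.AtPrime n)).injective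
  refine hinj ?_
  rw [hcomap]
  refine h _ inferInstance ((Ideal.comap_mono hle).trans_eq hcomap) fun h0 ↦ hP ?_
  refine hinj (h0.trans ?_)
  rw [← RingHom.ker_eq_comap_bot, eq_comm, ← RingHom.injective_iff_ker_eq_bot]
  exact IsLocalization.injective _ n.primeCompl_le_nonZeroDivisors

/-- If a prime `p` of a finite type algebra over an algebraically closed field of characteristic zero
is covered by the maximal ideal `m` in the poset of primes, then the integral curve cut out by `p` is
dominated by a smooth affine curve with a rational point over `m`. -/
theorem exists_isStandardSmooth_algHom {k A : Type} [Field k] [IsAlgClosed k] [CharZero k]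
    [CommRing A] [Algebra k A] [Algebra.FiniteType k A] (m p : Ideal A) [m.IsMaximal] [p.IsPrime]
    (hpm : p < m) (hcov : ∀ q : Ideal A, q.IsPrime → p < q → q ≤ m → q = m) :
    ∃ (D : Type) (_ : CommRing D) (_ : Algebra k D) (φ : A →ₐ[k] D) (ev : D →ₐ[k] k),
      IsDomain D ∧ Algebra.FiniteType k D ∧ Algebra.IsStandardSmoothOfRelativeDimension 1 k D ∧
      RingHom.ker φ = p ∧ ∀ a ∈ m, ev (φ a) = 0 := by
  let B := A ⧸ p
  let L := FractionRing B
  let S := integralClosure B L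
  have : Module.Finite B S := integralClosure_finite_of_finiteType k B L
  have : IsIntegrallyClosed S := integralClosure.isIntegrallyClosedOfFiniteExtension (R := B) L
  have : Algebra.FiniteType k S := Algebra.FiniteType.trans (S := B) inferInstance inferInstance
  have : IsNoetherianRing B := Algebra.FiniteType.isNoetherianRing k B
  have : IsNoetherianRing S := Algebra.FiniteType.isNoetherianRing k S
  have hBS : Function.Injective (algebraMap B S) :=
    FaithfulSMul.algebraMap_injective B S
  let π := Ideal.Quotient.mk p
  have hπ : Function.Surjective π := Ideal.Quotient.mk_surjective
  have hker : RingHom.ker π = p := Ideal.mk_ker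
  have hcm : (m.map π).comap π = m := by
    rw [Ideal.comap_map_of_surjective π hπ, ← RingHom.ker_eq_comap_bot, hker, sup_eq_left.2 hpm.le]
  have : (m.map π).IsMaximal :=
    (Ideal.map_eq_top_or_isMaximal_of_surjective π hπ ‹_›).resolve_left fun h ↦
      Ideal.IsPrime.ne_top' (hcm.symm.trans (h ▸ Ideal.comap_top))
  obtain ⟨n, hn, hnm⟩ := Ideal.exists_ideal_over_maximal_of_isIntegral (S := S) (m.map π)
    (by rw [(RingHom.injective_iff_ker_eq_bot _).1 hBS]; exact bot_le)
  have hcomp : (n.comap (algebraMap B S)).comap π = m := by rw [hnm, hcm]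
  have hn0 : n ≠ ⊥ := by
    rintro rfl
    rw [← RingHom.ker_eq_comap_bot, (RingHom.injective_iff_ker_eq_bot _).1 hBS,
      ← RingHom.ker_eq_comap_bot, hker] at hcomp
    exact hpm.ne hcomp
  have hprin := isPrincipal_maximalIdeal_localization_atPrime n fun q hq hqn hq0 ↦ by
    have h1 : p < (q.comap (algebraMap B S)).comap π := by
      refine lt_of_le_of_ne (hker.symm.trans_le (Ideal.ker_le_comap π)) fun h ↦ hq0 ?_
      refine Ideal.eq_bot_of_comap_eq_bot (R := B) (Ideal.comap_injective_of_surjective π hπ ?_)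
      rw [← h, ← RingHom.ker_eq_comap_bot, hker]
    have h2 := hcov _ inferInstance h1 (hcomp ▸ Ideal.comap_mono (Ideal.comap_mono hqn))
    have h3 : q.comap (algebraMap B S) = m.map π :=
      Ideal.comap_injective_of_surjective π hπ (h2.trans hcm.symm)
    have := Ideal.isMaximal_of_isIntegral_of_isMaximal_comap (R := B) q (h3 ▸ ‹_›)
    exact this.eq_of_le hn.ne_top hqn
  obtain ⟨g, hg, hsm⟩ := exists_isStandardSmooth_of_isPrincipal (k := k) n hn0 hprin
  obtain ⟨ψ, hψ⟩ := Ideal.IsMaximal.exists_algHom_ker_eq (k := k) n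
  have hg0 : g ≠ 0 := fun h ↦ hg (h ▸ n.zero_mem)
  have hinj : Function.Injective (algebraMap S (Localization.Away g)) :=
    IsLocalization.injective _ (powers_le_nonZeroDivisors_of_noZeroDivisors hg0)
  have hunit : IsUnit (ψ g) := isUnit_iff_ne_zero.2 fun h ↦ hg (hψ ▸ h)
  refine ⟨Localization.Away g, inferInstance, inferInstance,
    (IsScalarTower.toAlgHom k S (Localization.Away g)).comp
      ((IsScalarTower.toAlgHom k B S).comp (Ideal.Quotient.mkₐ k p)),
    IsLocalization.Away.liftAlgHom g hunit,
    IsLocalization.isDomain_localization (powers_le_nonZeroDivisors_of_noZeroDivisors hg0),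
    inferInstance, hsm, ?_, fun a ha ↦ ?_⟩
  · ext a
    simp only [RingHom.mem_ker, AlgHom.comp_apply, IsScalarTower.coe_toAlgHom',
      map_eq_zero_iff _ hinj, map_eq_zero_iff _ hBS]
    exact Ideal.Quotient.eq_zero_iff_mem
  · rw [← hcomp] at ha
    simp only [AlgHom.comp_apply, IsScalarTower.coe_toAlgHom']
    rw [IsLocalization.Away.liftAlgHom_apply, IsLocalization.Away.lift_eq]
    exact (hψ.symm ▸ ha :)

open AlgebraicGeometry CategoryTheory

/-- The equalizer of two distinct morphisms from an affine scheme to a separated scheme is cut out by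
a nonzero ideal. -/
theorem exists_ideal_le_ker_of_comp_eq {S X : Scheme} {A : CommRingCat} (s : X ⟶ S) [IsSeparated s]
    (f g : Spec A ⟶ X) (h : f ≫ s = g ≫ s) (hfg : f ≠ g) :
    ∃ I : Ideal A, I ≠ ⊥ ∧ ∀ (D : CommRingCat) (φ : A ⟶ D),
      Spec.map φ ≫ f = Spec.map φ ≫ g → I ≤ RingHom.ker φ.hom := by
  let X' : Over S := Over.mk s
  let f' : Over.mk (f ≫ s) ⟶ X' := Over.homMk f rfl
  let g' : Over.mk (f ≫ s) ⟶ X' := Over.homMk g h.symm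
  have : IsSeparated X'.hom := ‹_›
  have hcond : (Limits.equalizer.ι f' g').left ≫ f = (Limits.equalizer.ι f' g').left ≫ g :=
    congr($(Limits.equalizer.condition f' g').left)
  obtain ⟨I, e, he⟩ := (IsClosedImmersion.Spec_iff
    (f := (Limits.equalizer.ι f' g').left)).1 inferInstance
  rw [he] at hcond
  simp only [Category.assoc, cancel_epi] at hcond
  refine ⟨I, ?_, fun D φ hφ ↦ ?_⟩
  · rintro rfl
    have : IsIso (CommRingCat.ofHom (Ideal.Quotient.mk (⊥ : Ideal A))) :=
      (ConcreteCategory.isIso_iff_bijective _).2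
        ⟨(injective_iff_map_eq_zero _).2 fun a ha ↦ Ideal.Quotient.eq_zero_iff_mem.1 ha,
          Ideal.Quotient.mk_surjective⟩
    exact hfg ((cancel_epi _).1 hcond)
  · let u : Over.mk (Spec.map φ ≫ f ≫ s) ⟶ Over.mk (f ≫ s) := Over.homMk (Spec.map φ) rfl
    let l := Limits.equalizer.lift (f := f') (g := g') u (by ext1; exact hφ)
    have hl : l.left ≫ (Limits.equalizer.ι f' g').left = Spec.map φ :=
      congr($(Limits.equalizer.lift_ι u _).left)
    rw [he] at hl
    obtain ⟨ψ, hψ⟩ : ∃ ψ, Spec.map ψ = l.left ≫ e.hom := Spec.map_surjective _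
    have hψφ : CommRingCat.ofHom (Ideal.Quotient.mk I) ≫ ψ = φ :=
      Spec.map_injective (by rw [Spec.map_comp, hψ, Category.assoc, hl])
    intro a ha
    rw [RingHom.mem_ker, ← hψφ, CommRingCat.comp_apply, CommRingCat.ofHom_apply,
      Ideal.Quotient.eq_zero_iff_mem.2 ha, map_zero]

theorem smoothOfRelativeDimension_Spec_map {n : ℕ} {R S : Type} [CommRing R] [CommRing S]
    [Algebra R S] [Algebra.IsStandardSmoothOfRelativeDimension n R S] :
    SmoothOfRelativeDimension n (Spec.map (CommRingCat.ofHom (algebraMap R S))) := by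
  rw [HasRingHomProperty.Spec_iff (P := @SmoothOfRelativeDimension n)]
  refine RingHom.locally_of RingHom.isStandardSmoothOfRelativeDimension_respectsIso _ ?_
  exact RingHom.isStandardSmoothOfRelativeDimension_algebraMap n |>.2 ‹_›

/-- The affine case: an infinite set of pointed morphisms from an affine integral variety would stay
infinite after restriction to a suitable smooth affine curve through the base point. -/
theorem finite_setOf_comp_eq_of_affine {k A : Type} [Field k] [IsAlgClosed k] [Uncountable k]
    [CharZero k] {X : Scheme} (sX : X ⟶ Spec (CommRingCat.of k)) [IsSeparated sX]
    (hgeom : ∀ (C : Scheme) (sC : C ⟶ Spec (CommRingCat.of k)),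
      IsIntegral C → SmoothOfRelativeDimension 1 sC →
      LocallyOfFiniteType sC → QuasiCompact sC → IsSeparated sC →
      ∀ (c : Spec (CommRingCat.of k) ⟶ C), c ≫ sC = 𝟙 (Spec (CommRingCat.of k)) →
      ∀ (x : Spec (CommRingCat.of k) ⟶ X), x ≫ sX = 𝟙 (Spec (CommRingCat.of k)) →
      {f : C ⟶ X | f ≫ sX = sC ∧ c ≫ f = x}.Finite)
    [CommRing A] [IsDomain A] [Algebra k A] [Algebra.FiniteType k A] (y : A →ₐ[k] k)
    (x : Spec (CommRingCat.of k) ⟶ X) (hx : x ≫ sX = 𝟙 (Spec (CommRingCat.of k))) :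
    {f : Spec (CommRingCat.of A) ⟶ X |
      f ≫ sX = Spec.map (CommRingCat.ofHom (algebraMap k A)) ∧
      Spec.map (CommRingCat.ofHom y.toRingHom) ≫ f = x}.Finite := by
  have : IsNoetherianRing A := Algebra.FiniteType.isNoetherianRing k A
  have hsurj : Function.Surjective y := fun a ↦ ⟨algebraMap k A a, y.commutes a⟩
  have : (RingHom.ker y).IsMaximal := RingHom.ker_isMaximal_of_surjective y hsurj
  obtain hm | hm := eq_bot_or_bot_lt (RingHom.ker y)
  · have : IsIso (CommRingCat.ofHom y.toRingHom) :=
      (ConcreteCategory.isIso_iff_bijective _).2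
        ⟨(RingHom.injective_iff_ker_eq_bot y).2 hm, hsurj⟩
    exact Set.Subsingleton.finite fun f hf g hg ↦ (cancel_epi _).1 (hf.2.trans hg.2.symm)
  by_contra hfin
  let F := Set.Infinite.natEmbedding _ hfin
  have hI : ∀ i : {i : ℕ × ℕ // i.1 ≠ i.2}, _ := fun i ↦
    exists_ideal_le_ker_of_comp_eq sX (F i.1.1).1 (F i.1.2).1
      ((F i.1.1).2.1.trans (F i.1.2).2.1.symm) fun h ↦ i.2 (F.injective (Subtype.ext h))
  choose I hI0 hI using hI
  obtain ⟨p, hp, hpm, hpI, hcov⟩ := exists_prime_covBy_forall_not_le (k := k) I hI0 _ hm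
  obtain ⟨D, _, _, φ, ev, _, _, _, hφ, hev⟩ :=
    exists_isStandardSmooth_algHom (k := k) (RingHom.ker y) p hpm hcov
  have hevy : ev.comp φ = y := by
    ext a
    have := hev (a - algebraMap k A (y a)) (by simp [RingHom.mem_ker])
    simpa [sub_eq_zero] using this
  have hD : LocallyOfFiniteType (Spec.map (CommRingCat.ofHom (algebraMap k D))) := by
    rw [HasRingHomProperty.Spec_iff (P := @LocallyOfFiniteType)]
    exact RingHom.finiteType_algebraMap.2 ‹_›
  have hc : Spec.map (CommRingCat.ofHom ev.toRingHom) ≫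
      Spec.map (CommRingCat.ofHom (algebraMap k D)) = 𝟙 _ := by
    rw [← Spec.map_comp, ← CommRingCat.ofHom_comp, ← Spec.map_id]
    exact congr(Spec.map (CommRingCat.ofHom $(ev.comp_algebraMap)))
  have hfinD := hgeom (Spec (CommRingCat.of D)) _ inferInstance
    smoothOfRelativeDimension_Spec_map hD inferInstance inferInstance _ hc x hx
  refine Set.infinite_of_injective_forall_mem (s := {f | _ ∧ _})
    (f := fun i ↦ Spec.map (CommRingCat.ofHom φ.toRingHom) ≫ (F i).1) (fun i j hij ↦ ?_)
    (fun i ↦ ⟨?_, ?_⟩) hfinD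
  · by_contra hne
    exact hpI ⟨(i, j), hne⟩ ((hI ⟨(i, j), hne⟩ _ _ hij).trans_eq hφ)
  · rw [Category.assoc, (F i).2.1, ← Spec.map_comp, ← CommRingCat.ofHom_comp]
    exact congr(Spec.map (CommRingCat.ofHom $(φ.comp_algebraMap)))
  · rw [← Category.assoc, ← Spec.map_comp, ← CommRingCat.ofHom_comp]
    exact (congr(Spec.map (CommRingCat.ofHom ($(hevy)).toRingHom) ≫ (F i).1) :).trans (F i).2.2

/- STATEMENT 2. `k` is an uncountable algebraically closed field of characteristic zero;
varieties over `k` are finite type separated schemes over `Spec k`, and `k`-points are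
sections of the structure morphism.  `X` is geometrically hyperbolic over `k`: for every
smooth integral curve `C` over `k` (integral, smooth of relative dimension 1, finite type,
separated over `k`), every `c ∈ C(k)` and every `x ∈ X(k)`, the set of `k`-morphisms
`f : C → X` with `f(c) = x` is finite.  Conclusion: for every integral variety `Y` over
`k`, every `y ∈ Y(k)` and every `x ∈ X(k)`, the set of `k`-morphisms `f : Y → X` with
`f(y) = x` is finite. -/
theorem stmt_2 (k : Type) [Field k] [IsAlgClosed k] [Uncountable k] [CharZero k]
    (X : Scheme) (sX : X ⟶ Spec (CommRingCat.of k))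
    [LocallyOfFiniteType sX] [QuasiCompact sX] [IsSeparated sX]
    (hgeom : ∀ (C : Scheme) (sC : C ⟶ Spec (CommRingCat.of k)),
      IsIntegral C → IsSmoothOfRelativeDimension 1 sC →
      LocallyOfFiniteType sC → QuasiCompact sC → IsSeparated sC →
      ∀ (c : Spec (CommRingCat.of k) ⟶ C), c ≫ sC = 𝟙 (Spec (CommRingCat.of k)) →
      ∀ (x : Spec (CommRingCat.of k) ⟶ X), x ≫ sX = 𝟙 (Spec (CommRingCat.of k)) →
      {f : C ⟶ X | f ≫ sX = sC ∧ c ≫ f = x}.Finite) :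
    ∀ (Y : Scheme) (sY : Y ⟶ Spec (CommRingCat.of k)),
      IsIntegral Y → LocallyOfFiniteType sY → QuasiCompact sY → IsSeparated sY →
      ∀ (y : Spec (CommRingCat.of k) ⟶ Y), y ≫ sY = 𝟙 (Spec (CommRingCat.of k)) →
      ∀ (x : Spec (CommRingCat.of k) ⟶ X), x ≫ sX = 𝟙 (Spec (CommRingCat.of k)) →
      {f : Y ⟶ X | f ≫ sX = sY ∧ y ≫ f = x}.Finite := by
  intro Y sY _ _ _ _ y hy x hx
  let y₀ : Spec (CommRingCat.of k) := IsLocalRing.closedPoint k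
  obtain ⟨U, hU, hyU, -⟩ := exists_isAffineOpen_mem_and_subset (x := y y₀) (U := ⊤) trivial
  have : Nonempty U := ⟨⟨_, hyU⟩⟩
  have hrange : Set.range y ⊆ Set.range hU.fromSpec := by
    rintro _ ⟨z, rfl⟩
    rw [hU.range_fromSpec, Subsingleton.elim z y₀]
    exact hyU
  obtain ⟨α, hα⟩ := Spec.map_surjective (hU.fromSpec ≫ sY)
  obtain ⟨β, hβ⟩ := Spec.map_surjective (IsOpenImmersion.lift hU.fromSpec y hrange)
  have hβy : Spec.map β ≫ hU.fromSpec = y := by rw [hβ, IsOpenImmersion.lift_fac]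
  have hαβ : α ≫ β = 𝟙 _ := Spec.map_injective <| by
    rw [Spec.map_comp, hα, ← Category.assoc, hβy, hy, Spec.map_id]
  algebraize [α.hom]
  have : LocallyOfFiniteType (Spec.map α) := hα ▸ inferInstance
  have : Algebra.FiniteType k Γ(Y, U) :=
    (HasRingHomProperty.Spec_iff (P := @LocallyOfFiniteType)).1 this
  let yA : Γ(Y, U) →ₐ[k] k :=
    { β.hom with commutes' := fun a ↦ congr($(hαβ).hom a) }
  have : IsDominant hU.fromSpec := by
    refine ⟨?_⟩
    rw [DenseRange, hU.range_fromSpec]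
    exact U.2.dense ⟨_, hyU⟩
  refine Set.Finite.of_finite_image (f := fun f ↦ hU.fromSpec ≫ f)
    ((finite_setOf_comp_eq_of_affine sX hgeom yA x hx).subset ?_) fun f hf g hg hfg ↦
      ext_of_isDominant_of_isSeparated sX (hf.1.trans hg.1.symm) hU.fromSpec hfg
  rintro _ ⟨f, ⟨hf, hyf⟩, rfl⟩
  refine ⟨?_, ?_⟩
  · rw [Category.assoc, hf]
    exact hα.symm
  · rw [← hyf, ← hβy, Category.assoc]
    rfl
end

section
/- Let X be a smooth affine connected curve over ℂ with smooth projective model X̄ of genus g(X̄) = 1. If X̄ \ X consists of a single point, then Sym² X is not Brody hyperbolic. -/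
open Filter Topology

/-- Uniqueness for a second-order linear differential equation with zero initial data. -/
theorem eventually_eq_zero_of_deriv_deriv_eq_mul {d h : ℂ → ℂ} {c : ℂ}
    (hd : AnalyticAt ℂ d c) (hh : AnalyticAt ℂ h c) (h0 : d c = 0) (h1 : deriv d c = 0)
    (hode : deriv (deriv d) =ᶠ[𝓝 c] fun u ↦ h u * d u) : ∀ᶠ u in 𝓝 c, d u = 0 := by
  rw [← analyticOrderAt_eq_top]
  have e1 := hd.analyticOrderAt_deriv_add_one
  have e2 := hd.deriv.analyticOrderAt_deriv_add_one
  simp only [h0, h1, sub_zero] at e1 e2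
  have e3 : analyticOrderAt d c ≤ analyticOrderAt (deriv (deriv d)) c := by
    rw [analyticOrderAt_congr hode]
    change _ ≤ analyticOrderAt (h * d) c
    rw [analyticOrderAt_mul hh hd]
    exact le_add_self
  rw [← e1, ← e2] at e3
  by_contra hne
  rw [← e1, ← e2] at hne
  generalize analyticOrderAt (deriv (deriv d)) c = n at *
  cases n with
  | top => simp at hne
  | coe n =>
    norm_cast at e3
    omega

theorem exists_analyticAt_local_inverse {f : ℂ → ℂ} {x : ℂ} (hf : AnalyticAt ℂ f x)
    (hf' : deriv f x ≠ 0) :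
    ∃ r : ℂ → ℂ, AnalyticAt ℂ r (f x) ∧ r (f x) = x ∧ ∀ᶠ z in 𝓝 (f x), f (r z) = z :=
  ⟨_, hf.analyticAt_localInverse hf', HasStrictFDerivAt.localInverse_apply_image ..,
    HasStrictDerivAt.eventually_right_inverse ..⟩

theorem continuousAt_sqrt_zero : ContinuousAt Complex.sqrt 0 := by
  unfold Complex.sqrt
  exact Complex.continuousAt_cpow_const_of_re_pos (by simp) (by norm_num)

/-- An even analytic function of `u` is an analytic function of `u ^ 2`. -/
theorem exists_analyticAt_comp_sq {G : ℂ → ℂ} (hG : AnalyticAt ℂ G 0)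
    (heven : ∀ u, G (-u) = G u) : ∃ g : ℂ → ℂ, AnalyticAt ℂ g 0 ∧ ∀ u, G u = g (u ^ 2) := by
  have hsq : ∀ u : ℂ, G (Complex.sqrt (u ^ 2)) = G u := by
    intro u
    have : (Complex.sqrt (u ^ 2)) ^ 2 = u ^ 2 := by simp [Complex.sqrt]
    rcases sq_eq_sq_iff_eq_or_eq_neg.mp this with h | h <;> simp [h, heven]
  refine ⟨fun w ↦ G w.sqrt, ?_, fun u ↦ (hsq u).symm⟩
  have hcG : ContinuousAt G (Complex.sqrt 0) := by rw [Complex.sqrt_zero]; exact hG.continuousAt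
  apply Complex.analyticAt_of_differentiable_on_punctured_nhds_of_continuousAt
  · have hev : ∀ᶠ w in 𝓝 (0 : ℂ), AnalyticAt ℂ G w.sqrt :=
      continuousAt_sqrt_zero.eventually (p := AnalyticAt ℂ G)
        (by rw [Complex.sqrt_zero]; exact hG.eventually_analyticAt)
    filter_upwards [hev.filter_mono nhdsWithin_le_nhds, self_mem_nhdsWithin] with w hw hw0
    by_cases hslit : w ∈ Complex.slitPlane
    · have : DifferentiableAt ℂ Complex.sqrt w := by
        unfold Complex.sqrt
        exact DifferentiableAt.cpow_const (by fun_prop) hslit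
      exact hw.differentiableAt.comp w this
    · have hslit' : -w ∈ Complex.slitPlane := by
        rw [Complex.mem_slitPlane_iff] at *
        have : w.re ≠ 0 ∨ w.im ≠ 0 := by
          by_contra! h
          exact hw0 (Complex.ext h.1 h.2)
        simp only [Complex.neg_re, Complex.neg_im]
        grind
      have hD : DifferentiableAt ℂ (fun w : ℂ ↦ Complex.I * Complex.sqrt (-w)) w := by
        unfold Complex.sqrt
        exact (DifferentiableAt.cpow_const (by fun_prop) hslit').const_mul _
      have hIs : ∀ w : ℂ, (Complex.I * Complex.sqrt (-w)) ^ 2 = w := by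
        intro w
        simp [mul_pow, Complex.sqrt]
      have hGe : (fun w : ℂ ↦ G w.sqrt) = fun w ↦ G (Complex.I * Complex.sqrt (-w)) := by
        ext w
        rw [← hsq (Complex.I * Complex.sqrt (-w)), hIs]
      have hw' : AnalyticAt ℂ G (Complex.I * Complex.sqrt (-w)) := by
        have : (Complex.sqrt w) ^ 2 = (Complex.I * Complex.sqrt (-w)) ^ 2 := by
          rw [hIs]; simp [Complex.sqrt]
        rcases sq_eq_sq_iff_eq_or_eq_neg.mp this with h | h
        · rwa [← h]
        · rw [h] at hw
          have hGn : G = fun u ↦ G (-u) := by ext u; rw [heven]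
          rw [hGn]
          exact hw.comp_of_eq (analyticAt_id.neg) rfl
      rw [hGe]
      exact hw'.differentiableAt.comp w hD
  · exact hcG.comp continuousAt_sqrt_zero

/-- Near a nondegenerate critical point at `0` of an even analytic function `G`, the value `G u`
determines `u ^ 2` analytically. -/
theorem exists_analyticAt_inverse_sq {G : ℂ → ℂ} (hG : AnalyticAt ℂ G 0)
    (heven : ∀ u, G (-u) = G u) (h2 : deriv (deriv G) 0 ≠ 0) :
    ∃ ψ : ℂ → ℂ, AnalyticAt ℂ ψ (G 0) ∧ ψ (G 0) = 0 ∧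
      ∀ᶠ z in 𝓝 (G 0), ∀ u, u ^ 2 = ψ z → G u = z := by
  obtain ⟨g, hg, hGg⟩ := exists_analyticAt_comp_sq hG heven
  have hg' : deriv g 0 ≠ 0 := by
    intro h0
    apply h2
    have hsq0 : Tendsto (fun u : ℂ ↦ u ^ 2) (𝓝 0) (𝓝 0) := by
      simpa using (continuous_pow 2).tendsto (0 : ℂ)
    have hev : deriv G =ᶠ[𝓝 0] fun u ↦ deriv g (u ^ 2) * (2 * u) := by
      filter_upwards [hsq0.eventually hg.eventually_analyticAt] with u hu
      have : G = fun u ↦ g (u ^ 2) := funext hGg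
      rw [this]
      have := hu.differentiableAt.hasDerivAt.comp u (hasDerivAt_pow 2 u)
      simpa [Function.comp_def] using this.deriv
    rw [hev.deriv_eq]
    have hd : HasDerivAt (fun u : ℂ ↦ deriv g (u ^ 2)) (deriv (deriv g) (0 ^ 2) * (2 * 0)) 0 := by
      have h3 : HasDerivAt (deriv g) (deriv (deriv g) (0 ^ 2)) ((0 : ℂ) ^ 2) := by
        simpa using hg.deriv.differentiableAt.hasDerivAt
      simpa [Function.comp_def] using h3.comp 0 (hasDerivAt_pow 2 (0 : ℂ))
    have := hd.fun_mul ((hasDerivAt_id (0 : ℂ)).const_mul 2)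
    simpa [h0] using this.deriv
  obtain ⟨ψ, h1, h2, h3⟩ := exists_analyticAt_local_inverse hg hg'
  have : g 0 = G 0 := by simp [hGg]
  rw [this] at h1 h2 h3
  refine ⟨ψ, h1, h2, ?_⟩
  filter_upwards [h3] with z hz u hu
  rw [hGg, hu, hz]

theorem isPreconnected_compl_of_countable {s : Set ℂ} (hs : s.Countable) : IsPreconnected sᶜ :=
  (hs.isPathConnected_compl_of_one_lt_rank (by simp)).isConnected.isPreconnected

namespace PeriodPair

variable (L : PeriodPair)

theorem countable_lattice : (L.lattice : Set ℂ).Countable := by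
  have : Countable L.lattice := L.latticeEquivProd.toEquiv.countable_iff.mpr inferInstance
  exact Set.countable_coe_iff.mp this

theorem eventually_notMem_lattice {a : ℂ} (ha : a ∉ L.lattice) : ∀ᶠ z in 𝓝 a, z ∉ L.lattice :=
  L.isClosed_lattice.isOpen_compl.mem_nhds ha

theorem eventually_nhdsNE_notMem_lattice (a : ℂ) : ∀ᶠ z in 𝓝[≠] a, z ∉ L.lattice := by
  rw [eventually_nhdsWithin_iff]
  filter_upwards [L.compl_lattice_sdiff_singleton_mem_nhds a] with z hz hza hzl
  exact hz ⟨hzl, hza⟩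

theorem tendsto_weierstrassP_cobounded {l : ℂ} (hl : l ∈ L.lattice) :
    Tendsto (weierstrassP L) (𝓝[≠] l) (Bornology.cobounded ℂ) :=
  tendsto_cobounded_of_meromorphicOrderAt_neg (by rw [L.order_weierstrassP l hl]; decide)

theorem analyticAt_weierstrassP {a : ℂ} (ha : a ∉ L.lattice) : AnalyticAt ℂ (weierstrassP L) a :=
  L.analyticOnNhd_weierstrassP a ha

theorem analyticAt_derivWeierstrassP {a : ℂ} (ha : a ∉ L.lattice) :
    AnalyticAt ℂ (derivWeierstrassP L) a :=
  L.analyticOnNhd_derivWeierstrassP a ha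

theorem not_eventually_weierstrassP_eq_const {a : ℂ} (ha : a ∉ L.lattice) (c : ℂ) :
    ¬ ∀ᶠ z in 𝓝 a, weierstrassP L z = c := by
  intro h
  have heq : Set.EqOn (weierstrassP L) (fun _ ↦ c) (L.lattice : Set ℂ)ᶜ :=
    L.analyticOnNhd_weierstrassP.eqOn_of_preconnected_of_eventuallyEq
      (fun _ _ ↦ analyticAt_const) (isPreconnected_compl_of_countable L.countable_lattice) ha h
  have h1 : Tendsto (weierstrassP L) (𝓝[≠] 0) (𝓝 c) := by
    refine tendsto_const_nhds.congr' ?_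
    filter_upwards [L.eventually_nhdsNE_notMem_lattice 0] with z hz
    exact (heq hz).symm
  exact h1.not_tendsto (Metric.disjoint_nhds_cobounded c)
    (L.tendsto_weierstrassP_cobounded L.lattice.zero_mem)

theorem hasDerivAt_weierstrassP {a : ℂ} (ha : a ∉ L.lattice) :
    HasDerivAt (weierstrassP L) (derivWeierstrassP L a) a := by
  simpa using (L.analyticAt_weierstrassP ha).differentiableAt.hasDerivAt

/-- The second-order differential equation satisfied by `℘`. -/
theorem deriv_derivWeierstrassP {a : ℂ} (ha : a ∉ L.lattice) :
    deriv (derivWeierstrassP L) a = 6 * weierstrassP L a ^ 2 - L.g₂ / 2 := by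
  have hP := L.analyticAt_weierstrassP ha
  have hP' := L.analyticAt_derivWeierstrassP ha
  set k : ℂ → ℂ := fun z ↦
    2 * deriv (derivWeierstrassP L) z - 12 * weierstrassP L z ^ 2 + L.g₂ with hk
  have hka : AnalyticAt ℂ k a := by
    have := hP'.deriv
    fun_prop
  have hprod : ∀ᶠ z in 𝓝 a, (derivWeierstrassP L * k) z = 0 := by
    filter_upwards [(L.eventually_notMem_lattice ha).eventually_nhds] with z hz
    have hz0 := hz.self_of_nhds
    have h1 := (L.analyticAt_derivWeierstrassP hz0).differentiableAt.hasDerivAt.fun_pow 2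
    have h2 := L.hasDerivAt_weierstrassP hz0
    have h3 := (((h2.fun_pow 3).const_mul 4).fun_sub (h2.const_mul L.g₂)).sub_const L.g₃
    have := h1.unique (h3.congr_of_eventuallyEq (hz.mono L.derivWeierstrassP_sq))
    simp only [Pi.mul_apply, hk]
    push_cast at this
    linear_combination this
  have hord := analyticOrderAt_eq_top.mpr hprod
  rw [analyticOrderAt_mul hP' hka] at hord
  rcases WithTop.add_eq_top.mp hord with h | h
  · exfalso
    have := hP.analyticOrderAt_deriv_add_one
    rw [deriv_weierstrassP, h] at this
    refine L.not_eventually_weierstrassP_eq_const ha (weierstrassP L a) ?_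
    filter_upwards [analyticOrderAt_eq_top.mp this.symm] with z hz
    exact sub_eq_zero.mp hz
  · have := (analyticOrderAt_eq_top.mp h).self_of_nhds
    simp only [hk] at this
    linear_combination this / 2

theorem sub_mem_lattice_of_weierstrassP_eq {a b : ℂ} (ha : a ∉ L.lattice) (hb : b ∉ L.lattice)
    (h : weierstrassP L a = weierstrassP L b)
    (h' : derivWeierstrassP L a = derivWeierstrassP L b) : b - a ∈ L.lattice := by
  set t := b - a with ht
  have hat : a + t = b := by simp [ht]
  have hshift : AnalyticAt ℂ (fun z ↦ weierstrassP L (z + t)) a :=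
    (L.analyticAt_weierstrassP hb).comp_of_eq (by fun_prop) hat
  have hnear : ∀ᶠ z in 𝓝 a, z ∉ L.lattice ∧ z + t ∉ L.lattice := by
    refine (L.eventually_notMem_lattice ha).and ?_
    have : Tendsto (fun z ↦ z + t) (𝓝 a) (𝓝 b) := by
      simpa [hat] using (continuous_add_const t).tendsto a
    exact this.eventually (L.eventually_notMem_lattice hb)
  have hd1 : ∀ z, z ∉ L.lattice → z + t ∉ L.lattice →
      deriv (fun z ↦ weierstrassP L z - weierstrassP L (z + t)) z =
        derivWeierstrassP L z - derivWeierstrassP L (z + t) := fun z hz hzt ↦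
    ((L.hasDerivAt_weierstrassP hz).sub
      (HasDerivAt.comp_add_const z t (L.hasDerivAt_weierstrassP hzt))).deriv
  have hev := eventually_eq_zero_of_deriv_deriv_eq_mul (c := a)
    (d := fun z ↦ weierstrassP L z - weierstrassP L (z + t))
    (h := fun z ↦ 6 * (weierstrassP L z + weierstrassP L (z + t)))
    ((L.analyticAt_weierstrassP ha).sub hshift)
    (analyticAt_const.mul ((L.analyticAt_weierstrassP ha).add hshift))
    (by simp [hat, h]) (by rw [hd1 a ha (hat ▸ hb), hat, h', sub_self]) (by
      filter_upwards [hnear.eventually_nhds] with z hz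
      have h1 : deriv (fun z ↦ weierstrassP L z - weierstrassP L (z + t)) =ᶠ[𝓝 z]
          fun z ↦ derivWeierstrassP L z - derivWeierstrassP L (z + t) :=
        hz.mono fun w hw ↦ hd1 w hw.1 hw.2
      obtain ⟨hz1, hz2⟩ := hz.self_of_nhds
      have h2 := (L.analyticAt_derivWeierstrassP hz1).differentiableAt.hasDerivAt.fun_sub
        (HasDerivAt.comp_add_const z t
          (L.analyticAt_derivWeierstrassP hz2).differentiableAt.hasDerivAt)
      rw [h1.deriv_eq, h2.deriv, L.deriv_derivWeierstrassP hz1, L.deriv_derivWeierstrassP hz2]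
      ring)
  set S : Set ℂ := L.lattice ∪ (fun z ↦ z + t) ⁻¹' L.lattice with hS
  have hSc : S.Countable :=
    L.countable_lattice.union (L.countable_lattice.preimage (add_left_injective t))
  have heq : Set.EqOn (weierstrassP L) (fun z ↦ weierstrassP L (z + t)) Sᶜ := by
    refine AnalyticOnNhd.eqOn_of_preconnected_of_eventuallyEq (z₀ := a)
      (fun z hz ↦ L.analyticAt_weierstrassP fun hz' ↦ hz (.inl hz'))
      (fun z hz ↦ (L.analyticAt_weierstrassP fun hz' ↦ hz (.inr hz')).comp_of_eq
        (by fun_prop) rfl) (isPreconnected_compl_of_countable hSc) ?_ ?_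
    · rintro (h | h)
      · exact ha h
      · exact hb (hat ▸ h)
    · exact hev.mono fun z hz ↦ sub_eq_zero.mp hz
  by_contra htL
  have h0t : Tendsto (fun z : ℂ ↦ z + t) (𝓝[≠] 0) (𝓝 t) := by
    simpa using ((continuous_add_const t).tendsto 0).mono_left nhdsWithin_le_nhds
  have h1 : Tendsto (weierstrassP L) (𝓝[≠] 0) (𝓝 (weierstrassP L t)) := by
    refine ((L.analyticAt_weierstrassP htL).continuousAt.tendsto.comp h0t).congr' ?_
    filter_upwards [L.eventually_nhdsNE_notMem_lattice 0,
      h0t.eventually (L.eventually_notMem_lattice htL)] with z hz hz'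
    refine (heq ?_).symm
    rintro (h | h)
    exacts [hz h, hz' h]
  exact h1.not_tendsto (Metric.disjoint_nhds_cobounded _)
    (L.tendsto_weierstrassP_cobounded L.lattice.zero_mem)

/-- The fibres of `℘` are exactly the pairs `±a` modulo the lattice. -/
theorem weierstrassP_eq_iff {a b : ℂ} (ha : a ∉ L.lattice) (hb : b ∉ L.lattice) :
    weierstrassP L a = weierstrassP L b ↔ b - a ∈ L.lattice ∨ b + a ∈ L.lattice := by
  constructor
  · intro h
    have hsq : derivWeierstrassP L a ^ 2 = derivWeierstrassP L b ^ 2 := by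
      rw [L.derivWeierstrassP_sq a ha, L.derivWeierstrassP_sq b hb, h]
    rcases sq_eq_sq_iff_eq_or_eq_neg.mp hsq with h' | h'
    · exact .inl (L.sub_mem_lattice_of_weierstrassP_eq ha hb h h')
    · right
      simpa using L.sub_mem_lattice_of_weierstrassP_eq (a := -a) (by simpa using ha) hb
        (by simpa using h) (by simp [h'])
  · rintro (h | h)
    · simpa using (L.weierstrassP_add_coe a ⟨_, h⟩).symm
    · simpa using (L.weierstrassP_add_coe (-a) ⟨_, h⟩).symm

/-- `℘` takes every complex value. -/
theorem exists_weierstrassP_eq (w : ℂ) : ∃ a ∉ L.lattice, weierstrassP L a = w := by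
  classical
  by_contra! hne
  set h : ℂ → ℂ := fun z ↦ if z ∈ L.lattice then 0 else (weierstrassP L z - w)⁻¹ with hh
  have hoff : ∀ z, z ∉ L.lattice → DifferentiableAt ℂ h z := by
    intro z hz
    have h1 : DifferentiableAt ℂ (fun z ↦ (weierstrassP L z - w)⁻¹) z :=
      ((L.analyticAt_weierstrassP hz).differentiableAt.sub_const w).inv
        (sub_ne_zero.mpr (hne z hz))
    refine h1.congr_of_eventuallyEq ?_
    filter_upwards [L.eventually_notMem_lattice hz] with u hu
    simp [hh, hu]
  have hdiff : Differentiable ℂ h := by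
    intro z
    by_cases hz : z ∈ L.lattice
    · apply AnalyticAt.differentiableAt
      apply Complex.analyticAt_of_differentiable_on_punctured_nhds_of_continuousAt
      · exact (L.eventually_nhdsNE_notMem_lattice z).mono hoff
      · rw [continuousAt_iff_punctured_nhds]
        have h0 : h z = 0 := by simp [hh, hz]
        rw [h0]
        have h1 : Tendsto (fun u ↦ weierstrassP L u - w) (𝓝[≠] z) (Bornology.cobounded ℂ) := by
          exact (tendsto_sub_const_cobounded w).comp (L.tendsto_weierstrassP_cobounded hz)
        refine (tendsto_inv₀_cobounded.comp h1).congr' ?_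
        filter_upwards [L.eventually_nhdsNE_notMem_lattice z] with u hu
        simp [hh, hu]
    · exact hoff z hz
  have hper : ∀ z l, l ∈ L.lattice → h (z + l) = h z := by
    intro z l hl
    have h1 := L.weierstrassP_add_coe z ⟨l, hl⟩
    simp only at h1
    simp only [hh, L.lattice.add_mem_iff_left hl, h1]
  have hconst := hdiff.apply_eq_apply_of_bounded
    (IsZLattice.isCompact_range_of_periodic L.lattice _ hdiff.continuous hper).isBounded
    (L.ω₁ / 2) 0
  simp only [hh, L.ω₁_div_two_notMem_lattice, if_false, L.lattice.zero_mem, if_true,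
    inv_eq_zero] at hconst
  exact hne _ L.ω₁_div_two_notMem_lattice (sub_eq_zero.mp hconst)

/-- The elementary symmetric functions of suitable lifts of the fibre of `℘` are analytic. -/
theorem exists_local_sections (z₀ : ℂ) : ∃ s p : ℂ → ℂ, AnalyticAt ℂ s z₀ ∧ AnalyticAt ℂ p z₀ ∧
    ∀ᶠ z in 𝓝 z₀, ∃ a b : ℂ, a ∉ L.lattice ∧ weierstrassP L a = z ∧ a + b ∈ L.lattice ∧
      a + b = s z ∧ a * b = p z := by
  obtain ⟨a, ha, rfl⟩ := L.exists_weierstrassP_eq z₀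
  have hP := L.analyticAt_weierstrassP ha
  by_cases h' : derivWeierstrassP L a = 0
  · have hna : -a ∉ L.lattice := by simpa using ha
    have h2a : a - -a ∈ L.lattice :=
      L.sub_mem_lattice_of_weierstrassP_eq hna ha (by simp) (by simp [h'])
    have h'' : deriv (derivWeierstrassP L) a ≠ 0 := by
      intro h''
      rw [L.deriv_derivWeierstrassP ha] at h''
      have hderiv : deriv (fun z ↦ weierstrassP L z - weierstrassP L a) = derivWeierstrassP L := by
        ext z; simp [deriv_sub_const_fun]
      have := eventually_eq_zero_of_deriv_deriv_eq_mul (c := a)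
        (d := fun z ↦ weierstrassP L z - weierstrassP L a)
        (h := fun z ↦ 6 * (weierstrassP L z + weierstrassP L a))
        (by fun_prop) (by fun_prop) (by simp) (by rw [hderiv, h']) (by
          rw [hderiv]
          filter_upwards [L.eventually_notMem_lattice ha] with z hz
          rw [L.deriv_derivWeierstrassP hz]
          linear_combination h'')
      exact L.not_eventually_weierstrassP_eq_const ha _ (this.mono fun z hz ↦ sub_eq_zero.mp hz)
    obtain ⟨ψ, hψ, hψ0, hψG⟩ := exists_analyticAt_inverse_sq
      (G := fun u ↦ weierstrassP L (a + u)) (hP.comp_of_eq (by fun_prop) (by simp))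
      (fun u ↦ by
        have := L.weierstrassP_add_coe (-(a + u)) ⟨_, h2a⟩
        rw [L.weierstrassP_neg] at this
        rw [← this]
        congr 1
        simp only
        ring)
      (by
        have h1 : deriv (fun u ↦ weierstrassP L (a + u)) = fun u ↦ derivWeierstrassP L (a + u) := by
          ext u
          rw [deriv_comp_const_add, deriv_weierstrassP]
        rw [h1, deriv_comp_const_add]
        simpa using h'')
    simp only [add_zero] at hψ hψ0 hψG
    have hcont : Tendsto (fun z ↦ a + Complex.sqrt (ψ z)) (𝓝 (weierstrassP L a)) (𝓝 a) := by
      have := (continuousAt_sqrt_zero.tendsto.comp (hψ0 ▸ hψ.continuousAt.tendsto)).const_add a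
      simpa using this
    refine ⟨fun _ ↦ 2 * a, fun z ↦ a ^ 2 - ψ z, analyticAt_const, by fun_prop, ?_⟩
    filter_upwards [hψG, hcont.eventually (L.eventually_notMem_lattice ha)] with z hz hz'
    have hsq : Complex.sqrt (ψ z) ^ 2 = ψ z := by simp [Complex.sqrt]
    refine ⟨a + Complex.sqrt (ψ z), a - Complex.sqrt (ψ z), hz', hz _ hsq, ?_, by ring, ?_⟩
    · convert! h2a using 1
      ring
    · linear_combination -hsq
  · obtain ⟨r, hr, hra, hrP⟩ := exists_analyticAt_local_inverse hP (by simpa using h')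
    refine ⟨fun _ ↦ 0, fun z ↦ -(r z) ^ 2, analyticAt_const, by fun_prop, ?_⟩
    have hrt : Tendsto r (𝓝 (weierstrassP L a)) (𝓝 a) := by
      simpa [hra] using hr.continuousAt.tendsto
    filter_upwards [hrP, hrt.eventually (L.eventually_notMem_lattice ha)] with z hz hz'
    exact ⟨r z, -r z, hz', hz, by simp, by simp, by ring⟩

end PeriodPair


/- STATEMENT 12. A smooth affine connected curve `X` over `ℂ` whose smooth projective
model `X̄` has genus 1 with `X̄ \ X` a single point: analytically `X̄ = ℂ/Λ` for a lattice
`Λ = ℤω₁ + ℤω₂` (`ω₁, ω₂` ℝ-linearly independent), and we may take the missing point to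
be `0`.  `Sym² X` is the set of size-2 multisets of points of `E = ℂ/Λ` avoiding `0`.
"Not Brody hyperbolic" = there is a non-constant holomorphic map `F : ℂ → Sym² X`, where
holomorphy of a map into the symmetric square is expressed through local charts: near
every point, the elementary symmetric functions `s = a + b`, `p = a·b` of local lifts
`a, b ∈ ℂ` of the two points of the divisor are analytic. -/
theorem stmt_12 (ω₁ ω₂ : ℂ) (hω : LinearIndependent ℝ ![ω₁, ω₂]) :
    ∃ F : ℂ → Multiset (ℂ ⧸ AddSubgroup.closure {ω₁, ω₂}),
      (∀ z, Multiset.card (F z) = 2 ∧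
        (0 : ℂ ⧸ AddSubgroup.closure {ω₁, ω₂}) ∉ F z) ∧
      (∃ z w : ℂ, F z ≠ F w) ∧
      (∀ z₀ : ℂ, ∃ s p : ℂ → ℂ, AnalyticAt ℂ s z₀ ∧ AnalyticAt ℂ p z₀ ∧
        ∀ᶠ z in nhds z₀, ∃ a b : ℂ,
          F z = {QuotientAddGroup.mk a, QuotientAddGroup.mk b} ∧
          a + b = s z ∧ a * b = p z) := by
  set Λ := AddSubgroup.closure {ω₁, ω₂} with hΛ
  let L : PeriodPair := ⟨ω₁, ω₂, hω⟩
  have hmem : ∀ x, x ∈ Λ ↔ x ∈ L.lattice := by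
    intro x
    simp [hΛ, AddSubgroup.mem_closure_pair, PeriodPair.mem_lattice, L]
  have hmk : ∀ x y : ℂ, (QuotientAddGroup.mk x : ℂ ⧸ Λ) = QuotientAddGroup.mk y ↔
      y - x ∈ L.lattice := by
    intro x y
    rw [QuotientAddGroup.eq, hmem, neg_add_eq_sub]
  choose α hα hαP using L.exists_weierstrassP_eq
  refine ⟨fun z ↦ {QuotientAddGroup.mk (α z), QuotientAddGroup.mk (-α z)}, fun z ↦ ⟨by simp, ?_⟩,
    ⟨0, 1, fun h ↦ ?_⟩, fun z₀ ↦ ?_⟩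
  · have h0 : (0 : ℂ ⧸ Λ) = QuotientAddGroup.mk 0 := rfl
    have hz := hα z
    simp only [Multiset.insert_eq_cons, Multiset.mem_cons, Multiset.mem_singleton, h0, hmk]
    simpa using hz
  · have h1 : (QuotientAddGroup.mk (α 0) : ℂ ⧸ Λ) ∈
        ({QuotientAddGroup.mk (α 1), QuotientAddGroup.mk (-α 1)} : Multiset (ℂ ⧸ Λ)) := by
      refine (congrArg (_ ∈ ·) h).mp ?_
      simp
    simp only [Multiset.insert_eq_cons, Multiset.mem_cons, Multiset.mem_singleton, hmk] at h1
    have h2 : α 1 - α 0 ∈ L.lattice ∨ α 1 + α 0 ∈ L.lattice := by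
      refine h1.imp_right fun h ↦ ?_
      rw [← L.lattice.neg_mem_iff]
      convert! h using 1
      ring
    have h3 := (L.weierstrassP_eq_iff (hα 0) (hα 1)).mpr h2
    simp [hαP] at h3
  · obtain ⟨s, p, hs, hp, hsp⟩ := L.exists_local_sections z₀
    refine ⟨s, p, hs, hp, ?_⟩
    filter_upwards [hsp] with z ⟨a, b, ha, haP, hab, has, hap⟩
    refine ⟨a, b, ?_, has, hap⟩
    rcases (L.weierstrassP_eq_iff (hα z) ha).mp ((hαP z).trans haP.symm) with h | h
    · have e1 : (QuotientAddGroup.mk (α z) : ℂ ⧸ Λ) = QuotientAddGroup.mk a := (hmk _ _).mpr h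
      have e2 : (QuotientAddGroup.mk (-α z) : ℂ ⧸ Λ) = QuotientAddGroup.mk b := by
        rw [hmk]
        convert! L.lattice.sub_mem hab h using 1
        ring
      rw [e1, e2]
    · have e1 : (QuotientAddGroup.mk (-α z) : ℂ ⧸ Λ) = QuotientAddGroup.mk a := by
        rw [hmk]
        simpa using h
      have e2 : (QuotientAddGroup.mk (α z) : ℂ ⧸ Λ) = QuotientAddGroup.mk b := by
        rw [hmk]
        convert! L.lattice.sub_mem hab h using 1
        ring
      rw [e1, e2]
      exact Multiset.pair_comm _ _
end

section
/- Let X be a variety over an algebraically closed field k of characteristic zero and suppose X is arithmetically hyperbolic over k. Then there is no non-constant morphism 𝔾_{m,k} → X and no non-constant morphism from an abelian variety over k to X (i.e., X is groupless). -/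
open AlgebraicGeometry CategoryTheory CategoryTheory.Limits

/-- An abelian variety over a base scheme `Sk` (= `Spec k`): an integral scheme, proper
and smooth over the base, equipped with a commutative group law given by morphisms
`mul`, `one`, `inv` over the base, the group axioms being expressed on `T`-points. -/
structure AbelianVarietyOver (Sk : Scheme) where
  Ab : Scheme
  s : Ab ⟶ Sk
  integral : IsIntegral Ab
  proper : IsProper s
  smooth : IsSmooth s
  mul : pullback s s ⟶ Ab
  mul_over : mul ≫ s = pullback.fst s s ≫ s
  one : Sk ⟶ Ab
  one_over : one ≫ s = 𝟙 Sk
  inv : Ab ⟶ Ab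
  inv_over : inv ≫ s = s
  mul_assoc' : ∀ (T : Scheme) (a b c : T ⟶ Ab) (hab : a ≫ s = b ≫ s)
      (hbc : b ≫ s = c ≫ s) (h₁ : (pullback.lift a b hab ≫ mul) ≫ s = c ≫ s)
      (h₂ : a ≫ s = (pullback.lift b c hbc ≫ mul) ≫ s),
      pullback.lift (pullback.lift a b hab ≫ mul) c h₁ ≫ mul =
        pullback.lift a (pullback.lift b c hbc ≫ mul) h₂ ≫ mul
  one_mul' : ∀ (T : Scheme) (a : T ⟶ Ab) (h : (a ≫ s ≫ one) ≫ s = a ≫ s),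
      pullback.lift (a ≫ s ≫ one) a h ≫ mul = a
  mul_inv' : ∀ (T : Scheme) (a : T ⟶ Ab) (h : a ≫ s = (a ≫ inv) ≫ s),
      pullback.lift a (a ≫ inv) h ≫ mul = a ≫ s ≫ one
  mul_comm' : ∀ (T : Scheme) (a b : T ⟶ Ab) (hab : a ≫ s = b ≫ s),
      pullback.lift a b hab ≫ mul = pullback.lift b a hab.symm ≫ mul

section TensorProducts

open scoped TensorProduct

section LargeSubrings

variable (k : Type) [Field k]

/-- The filter of subrings of `k` generated by the sets `{R | c ∈ R}`, `c ∈ k`: a property holds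
eventually along it if it holds for all subrings containing a suitable finite set. -/
def largeSubrings : Filter (Subring k) := ⨅ c : k, Filter.principal {R | c ∈ R}

/-- The filter of valuation subrings of `k` induced by `largeSubrings`. -/
def largeValuationSubrings : Filter (ValuationSubring k) :=
  (largeSubrings k).comap ValuationSubring.toSubring

variable {k}

lemma eventually_mem_largeSubrings (c : k) : ∀ᶠ R in largeSubrings k, c ∈ R :=
  Filter.mem_iInf_of_mem c (Filter.mem_principal_self _)

lemma eventually_mem_largeValuationSubrings (c : k) :
    ∀ᶠ V in largeValuationSubrings k, V.valuation c ≤ 1 := by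
  have := (eventually_mem_largeSubrings c).comap ValuationSubring.toSubring
  filter_upwards [this] with V hV
  exact (ValuationSubring.valuation_le_one_iff V c).mpr hV

lemma exists_finite_of_eventually_largeSubrings {p : Subring k → Prop}
    (h : ∀ᶠ R in largeSubrings k, p R) :
    ∃ C : Set k, C.Finite ∧ ∀ R : Subring k, C ⊆ R → p R := by
  obtain ⟨I, hI, U, hU, hpU⟩ := Filter.mem_iInf.mp h
  refine ⟨I, hI, fun R hR ↦ ?_⟩
  change R ∈ {R | p R}
  rw [hpU]
  exact Set.mem_iInter.mpr fun i ↦ Filter.mem_principal.mp (hU i) (hR i.2)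

lemma exists_finite_of_eventually_largeValuationSubrings {p : ValuationSubring k → Prop}
    (h : ∀ᶠ V in largeValuationSubrings k, p V) :
    ∃ C : Set k, C.Finite ∧ ∀ V : ValuationSubring k, C ⊆ V → p V := by
  obtain ⟨t, ht, htp⟩ := Filter.mem_comap.mp h
  obtain ⟨C, hC, hCt⟩ := exists_finite_of_eventually_largeSubrings ht
  exact ⟨C, hC, fun V hV ↦ htp (hCt _ hV)⟩

end LargeSubrings

section Values

variable {k : Type} [Field k] {S : Type} [CommRing S] [Algebra k S]

/-- Values at `k`-points of a fixed function are in `R` if those of algebra generators are, for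
all large enough `R`. -/
lemma eventually_forall_apply_mem {G : Set S} (hG : Algebra.adjoin k G = ⊤) (x : S) :
    ∀ᶠ R in largeSubrings k, ∀ χ : S →ₐ[k] k, (∀ g ∈ G, χ g ∈ R) → χ x ∈ R := by
  have hx : x ∈ Algebra.adjoin k G := hG ▸ Algebra.mem_top
  induction hx using Algebra.adjoin_induction with
  | mem g hg => exact .of_forall fun R χ h ↦ h g hg
  | algebraMap c =>
    filter_upwards [eventually_mem_largeSubrings c] with R hR χ h
    simpa using hR
  | add a b _ _ ha hb =>
    filter_upwards [ha, hb] with R ha hb χ h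
    simpa using add_mem (ha χ h) (hb χ h)
  | mul a b _ _ ha hb =>
    filter_upwards [ha, hb] with R ha hb χ h
    simpa using mul_mem (ha χ h) (hb χ h)

/-- The `k`-point `χ` is `V`-adically close to `ε`, as measured by the functions in `G`. -/
def IsCloseTo (V : ValuationSubring k) (G : Set S) (ε χ : S →ₐ[k] k) : Prop :=
  ∀ g ∈ G, V.valuation (χ g - ε g) < 1

lemma valuation_mul_sub_mul_lt_one (V : ValuationSubring k) {a b a' b' : k}
    (ha : V.valuation (a - a') < 1) (hb : V.valuation (b - b') < 1)
    (ha' : V.valuation a' ≤ 1) (hb' : V.valuation b' ≤ 1) :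
    V.valuation (a * b - a' * b') < 1 := by
  have h : a * b - a' * b' = (a - a') * (b - b') + (a' * (b - b') + b' * (a - a')) := by ring
  rw [h]
  refine Valuation.map_add_lt _ ?_ (Valuation.map_add_lt _ ?_ ?_) <;> rw [map_mul]
  · exact mul_lt_one_of_nonneg_of_lt_one_left zero_le ha hb.le
  · exact mul_lt_one_of_nonneg_of_lt_one_right ha' zero_le hb
  · exact mul_lt_one_of_nonneg_of_lt_one_right hb' zero_le ha

lemma eventually_valuation_sub_lt_one {G : Set S} (hG : Algebra.adjoin k G = ⊤) (ε : S →ₐ[k] k)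
    (x : S) : ∀ᶠ V in largeValuationSubrings k, ∀ χ : S →ₐ[k] k, IsCloseTo V G ε χ →
      V.valuation (χ x - ε x) < 1 := by
  have hx : x ∈ Algebra.adjoin k G := hG ▸ Algebra.mem_top
  induction hx using Algebra.adjoin_induction with
  | mem g hg => exact .of_forall fun R χ h ↦ h g hg
  | algebraMap c => exact .of_forall fun R χ h ↦ by simp
  | add a b _ _ ha hb =>
    filter_upwards [ha, hb] with V ha hb χ h
    rw [map_add, map_add, add_sub_add_comm]
    exact Valuation.map_add_lt _ (ha χ h) (hb χ h)
  | mul a b _ _ ha hb =>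
    filter_upwards [ha, hb, eventually_mem_largeValuationSubrings (ε a),
      eventually_mem_largeValuationSubrings (ε b)] with V ha hb hεa hεb χ h
    rw [map_mul, map_mul]
    exact valuation_mul_sub_mul_lt_one V (ha χ h) (hb χ h) hεa hεb

lemma eventually_valuation_apply_le_one {G : Set S} (hG : Algebra.adjoin k G = ⊤)
    (ε : S →ₐ[k] k) (x : S) : ∀ᶠ V in largeValuationSubrings k, ∀ χ : S →ₐ[k] k,
      IsCloseTo V G ε χ → V.valuation (χ x) ≤ 1 := by
  filter_upwards [eventually_valuation_sub_lt_one hG ε x,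
    eventually_mem_largeValuationSubrings (ε x)] with V h hε χ hχ
  rw [← sub_add_cancel (χ x) (ε x)]
  exact Valuation.map_add_le _ (h χ hχ).le hε

lemma eventually_valuation_apply_eq_one {G : Set S} (hG : Algebra.adjoin k G = ⊤)
    (ε : S →ₐ[k] k) {x : S} (hx : ε x ≠ 0) : ∀ᶠ V in largeValuationSubrings k,
      ∀ χ : S →ₐ[k] k, IsCloseTo V G ε χ → V.valuation (χ x) = 1 := by
  filter_upwards [eventually_valuation_sub_lt_one hG ε x,
    eventually_mem_largeValuationSubrings (ε x),
    eventually_mem_largeValuationSubrings (ε x)⁻¹] with V h hε hε' χ hχ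
  have h1 : V.valuation (ε x) = 1 := by
    refine le_antisymm hε ?_
    rw [map_inv₀] at hε'
    exact (inv_le_one₀ (by simpa [zero_lt_iff] using hx)).mp hε'
  rw [← sub_add_cancel (χ x) (ε x), Valuation.map_add_eq_of_lt_right _ (by rw [h1]; exact h χ hχ), h1]

/-- If `f` is in the ideal generated by the `x i`, up to a function not vanishing at `ε`, then
`f` is small where all the `x i` are. -/
lemma eventually_valuation_apply_le {G : Set S} (hG : Algebra.adjoin k G = ⊤) (ε : S →ₐ[k] k)
    {ι : Type} (x : ι → S) {t f : S} (ht : ε t ≠ 0)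
    (h : t * f ∈ Ideal.span (Set.range x)) :
    ∀ᶠ V in largeValuationSubrings k, ∀ χ : S →ₐ[k] k, IsCloseTo V G ε χ →
      ∀ c : V.ValueGroup, (∀ i, V.valuation (χ (x i)) ≤ c) → V.valuation (χ f) ≤ c := by
  have key : ∀ᶠ V in largeValuationSubrings k, ∀ χ : S →ₐ[k] k, IsCloseTo V G ε χ →
      ∀ c : V.ValueGroup, (∀ i, V.valuation (χ (x i)) ≤ c) → V.valuation (χ (t * f)) ≤ c := by
    refine Submodule.span_induction (p := fun z _ ↦ ∀ᶠ V in largeValuationSubrings k,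
      ∀ χ : S →ₐ[k] k, IsCloseTo V G ε χ → ∀ c : V.ValueGroup,
        (∀ i, V.valuation (χ (x i)) ≤ c) → V.valuation (χ z) ≤ c) ?_ ?_ ?_ ?_ h
    · rintro _ ⟨i, rfl⟩
      exact .of_forall fun V χ _ c hc ↦ hc i
    · exact .of_forall fun V χ _ c hc ↦ by simp
    · intro a b _ _ ha hb
      filter_upwards [ha, hb] with V ha hb χ hχ c hc
      rw [map_add]
      exact Valuation.map_add_le _ (ha χ hχ c hc) (hb χ hχ c hc)
    · intro a b _ hb
      filter_upwards [hb, eventually_valuation_apply_le_one hG ε a] with V hb ha χ hχ c hc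
      rw [smul_eq_mul, map_mul, map_mul]
      exact (mul_le_of_le_one_left' (ha χ hχ)).trans (hb χ hχ c hc)
  filter_upwards [key, eventually_valuation_apply_eq_one hG ε ht] with V hk h1 χ hχ c hc
  have := hk χ hχ c hc
  rwa [map_mul, map_mul, h1 χ hχ, one_mul] at this

end Values

section Charts

/-- The morphism of affine schemes induced by a ring homomorphism. -/
noncomputable abbrev specMap {R S : Type} [CommRing R] [CommRing S] (f : R →+* S) :
    Spec (CommRingCat.of S) ⟶ Spec (CommRingCat.of R) :=
  Spec.map (CommRingCat.ofHom f)

lemma specMap_comp {R S T : Type} [CommRing R] [CommRing S] [CommRing T] (g : S →+* T)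
    (f : R →+* S) : specMap (g.comp f) = specMap g ≫ specMap f := by
  rw [specMap, CommRingCat.ofHom_comp, Spec.map_comp]

lemma exists_eq_specMap {R S : Type} [CommRing R] [CommRing S]
    (q : Spec (CommRingCat.of S) ⟶ Spec (CommRingCat.of R)) : ∃ f : R →+* S, q = specMap f :=
  ⟨(Spec.preimage q).hom, (Spec.map_preimage q).symm⟩

lemma specMap_injective {R S : Type} [CommRing R] [CommRing S] :
    Function.Injective (specMap : (R →+* S) → _) := fun f g h ↦ by
  have := Spec.map_injective h
  exact congrArg CommRingCat.Hom.hom this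

lemma range_specMap_localizationAway {S : Type} [CommRing S] (s : S) :
    Set.range (specMap (algebraMap S (Localization.Away s))) = (PrimeSpectrum.basicOpen s : Set (PrimeSpectrum S)) :=
  PrimeSpectrum.localization_away_comap_range (Localization.Away s) s

variable {Y : Scheme}

/-- A morphism out of an affine scheme locally factors through an affine chart. -/
lemma exists_localizationAway_factors {S E : Type} [CommRing S] [CommRing E]
    (ψ : Spec (CommRingCat.of S) ⟶ Y) (j : Spec (CommRingCat.of E) ⟶ Y) [IsOpenImmersion j]
    (x : PrimeSpectrum S) (hx : ψ x ∈ Set.range j) :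
    ∃ s ∉ x.asIdeal, ∃ ρ : E →+* Localization.Away s,
      specMap (algebraMap S (Localization.Away s)) ≫ ψ = specMap ρ ≫ j := by
  obtain ⟨_, ⟨s, rfl⟩, hxs, hs⟩ := PrimeSpectrum.isTopologicalBasis_basic_opens.exists_subset_of_mem_open
    (a := x) (u := ψ ⁻¹' Set.range j) hx
    (j.isOpenEmbedding.isOpen_range.preimage ψ.continuous)
  have hr : Set.range (specMap (algebraMap S (Localization.Away s)) ≫ ψ) ⊆ Set.range j := by
    rintro _ ⟨z, rfl⟩
    rw [Scheme.Hom.comp_apply]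
    refine hs ?_
    exact (range_specMap_localizationAway s).le (Set.mem_range_self z)
  obtain ⟨ρ, hρ⟩ := exists_eq_specMap (IsOpenImmersion.lift j _ hr)
  exact ⟨s, hxs, ρ, by rw [← hρ, IsOpenImmersion.lift_fac]⟩

lemma exists_finite_affine_cover {A : Type} [CommRing A] (s : Y ⟶ Spec (CommRingCat.of A))
    [LocallyOfFiniteType s] [QuasiCompact s] :
    ∃ (ι : Type) (_ : Finite ι) (E : ι → Type) (_ : ∀ i, CommRing (E i))
      (_ : ∀ i, Algebra A (E i)) (j : ∀ i, Spec (CommRingCat.of (E i)) ⟶ Y)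
      (_ : ∀ i, IsOpenImmersion (j i)) (H : ∀ i, Set (E i)), (∀ i, (H i).Finite) ∧
      (∀ i, Algebra.adjoin A (H i) = ⊤) ∧ (∀ y, ∃ i, y ∈ Set.range (j i)) ∧
      ∀ i, j i ≫ s = specMap (algebraMap A (E i)) := by
  have : CompactSpace Y := QuasiCompact.compactSpace_of_compactSpace s
  let 𝒰 := Y.affineOpenCover
  obtain ⟨t, ht⟩ := CompactSpace.elim_nhds_subcover (fun y : Y ↦ Set.range (𝒰.f (𝒰.idx y)))
    fun y ↦ (𝒰.f (𝒰.idx y)).isOpenEmbedding.isOpen_range.mem_nhds (𝒰.covers y)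
  have hf (i) : ∃ f : A →+* 𝒰.X i, 𝒰.f i ≫ s = specMap f :=
    exists_eq_specMap (R := A) (S := 𝒰.X i) (𝒰.f i ≫ s)
  choose f hf using hf
  let alg (i) : Algebra A (𝒰.X i) := (f i).toAlgebra
  have hft (i) : (⊤ : Subalgebra A (𝒰.X i)).FG := by
    have h1 : LocallyOfFiniteType (specMap (f i)) := by
      rw [← hf]; infer_instance
    have h2 : (f i).FiniteType := (HasRingHomProperty.Spec_iff (P := @LocallyOfFiniteType)).mp h1
    exact h2.out
  choose H hH using hft
  refine ⟨t, inferInstance, fun y ↦ 𝒰.X (𝒰.idx y.1), inferInstance, fun y ↦ alg _,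
    fun y ↦ 𝒰.f (𝒰.idx y.1), fun y ↦ 𝒰.map_prop _, fun y ↦ H (𝒰.idx y.1),
    fun y ↦ Finset.finite_toSet _, fun y ↦ hH _, fun y ↦ ?_, fun y ↦ hf _⟩
  obtain ⟨z, hz, hy⟩ := Set.mem_iUnion₂.mp (ht.ge (Set.mem_univ y))
  exact ⟨⟨z, hz⟩, hy⟩

end Charts

section IntegralPoints

variable {k : Type} [Field k] {Y : Scheme} {ι : Type} {E : ι → Type} [∀ i, CommRing (E i)]

/-- The `k`-point `y` lies in one of the charts `j i` and the functions in `H i` take values in the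
subring `R` there. -/
def IsIntegralPoint (R : Subring k) (j : ∀ i, Spec (CommRingCat.of (E i)) ⟶ Y)
    (H : ∀ i, Set (E i)) (y : Spec (CommRingCat.of k) ⟶ Y) : Prop :=
  ∃ (i : ι) (χ : E i →+* k), y = specMap χ ≫ j i ∧ ∀ h ∈ H i, χ h ∈ R

lemma eventually_isIntegralPoint {S : Type} [CommRing S] [Algebra k S] {G : Set S}
    (hG : Algebra.adjoin k G = ⊤) (j : ∀ i, Spec (CommRingCat.of (E i)) ⟶ Y)
    [∀ i, IsOpenImmersion (j i)] (hj : ∀ y, ∃ i, y ∈ Set.range (j i))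
    (H : ∀ i, Set (E i)) (hH : ∀ i, (H i).Finite) (ψ : Spec (CommRingCat.of S) ⟶ Y) :
    ∀ᶠ R : Subring k in largeSubrings k, IsLocalRing R → ∀ χ : S →ₐ[k] k, (∀ g ∈ G, χ g ∈ R) →
      IsIntegralPoint R j H (specMap χ.toRingHom ≫ ψ) := by
  have hF (x : PrimeSpectrum S) : ∃ i, ∃ s ∉ x.asIdeal, ∃ ρ : E i →+* Localization.Away s,
      specMap (algebraMap S (Localization.Away s)) ≫ ψ = specMap ρ ≫ j i := by
    obtain ⟨i, hi⟩ := hj (ψ x)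
    exact ⟨i, exists_localizationAway_factors ψ (j i) x hi⟩
  choose i s hs ρ hρ using hF
  have hspan : Ideal.span (Set.range s) = ⊤ := by
    by_contra h
    obtain ⟨M, hM, hle⟩ := Ideal.exists_le_maximal _ h
    exact hs ⟨M, hM.isPrime⟩ (hle (Ideal.subset_span ⟨_, rfl⟩))
  obtain ⟨c, hc⟩ := Finsupp.mem_ideal_span_range_iff_exists_finsupp.mp
    (hspan ▸ Submodule.mem_top : (1 : S) ∈ Ideal.span (Set.range s))
  have hnum (x : PrimeSpectrum S) (h : E (i x)) : ∃ (n : S) (N : ℕ),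
      ρ x h * algebraMap S _ (s x ^ N) = algebraMap S _ n := by
    obtain ⟨⟨n, ⟨_, N, rfl⟩⟩, hn⟩ := IsLocalization.surj (Submonoid.powers (s x)) (ρ x h)
    exact ⟨n, N, hn⟩
  choose n N hn using hnum
  have h1 := (Filter.eventually_all_finset c.support).mpr fun x _ ↦
    eventually_forall_apply_mem hG (c x)
  have h2 := (Filter.eventually_all_finset c.support).mpr fun x _ ↦
    eventually_forall_apply_mem hG (s x)
  have h3 := (Filter.eventually_all_finset c.support).mpr fun x _ ↦
    (Filter.eventually_all_finite (hH (i x))).mpr fun h _ ↦ eventually_forall_apply_mem hG (n x h)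
  filter_upwards [h1, h2, h3] with R h1 h2 h3 hR χ hχ
  obtain ⟨x, hx, hxR⟩ : ∃ x ∈ c.support, χ (s x) ≠ 0 ∧ (χ (s x))⁻¹ ∈ R := by
    by_contra! hcon
    have hmem : (1 : R) ∈ IsLocalRing.maximalIdeal R := by
      have : (1 : R) = ∑ x ∈ c.support.attach,
          (⟨χ (c x), h1 x x.2 χ hχ⟩ * ⟨χ (s x), h2 x x.2 χ hχ⟩ : R) := by
        apply Subtype.ext
        have := congrArg χ hc
        rw [Finsupp.sum, map_sum, map_one] at this
        rw [AddSubmonoidClass.coe_finsetSum]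
        rw [← Finset.sum_attach] at this
        simpa using this.symm
      rw [this]
      refine Ideal.sum_mem _ fun x _ ↦ Ideal.mul_mem_left _ _ ?_
      rw [IsLocalRing.mem_maximalIdeal, mem_nonunits_iff]
      intro hu
      obtain ⟨b, hb⟩ := hu.exists_right_inv
      have hb' : χ (s x) * (b : k) = 1 := congrArg Subtype.val hb
      refine hcon x x.2 (left_ne_zero_of_mul_eq_one hb') ?_
      rw [← eq_inv_of_mul_eq_one_right hb']
      exact b.2
    exact (Ideal.ne_top_iff_one _).mp (IsLocalRing.maximalIdeal.isMaximal R).ne_top hmem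
  let χ' : Localization.Away (s x) →+* k :=
    IsLocalization.Away.lift (s x) (g := χ.toRingHom) (isUnit_iff_ne_zero.mpr hxR.1)
  have hχ' (a : S) : χ' (algebraMap S _ a) = χ a := IsLocalization.Away.lift_eq _ _ _
  refine ⟨i x, χ'.comp (ρ x), ?_, fun h hh ↦ ?_⟩
  · have : χ.toRingHom = χ'.comp (algebraMap S _) := RingHom.ext fun a ↦ (hχ' a).symm
    rw [this, specMap_comp χ', specMap_comp χ', Category.assoc, hρ, Category.assoc]
  · have h4 := congrArg χ' (hn x h)
    rw [map_mul, hχ', hχ', map_pow] at h4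
    rw [RingHom.comp_apply, eq_div_of_mul_eq (pow_ne_zero _ hxR.1) h4, div_eq_mul_inv, ← inv_pow]
    exact mul_mem (h3 x hx h hh χ hχ) (pow_mem hxR.2 _)

end IntegralPoints

section Descent

variable {k : Type} [Field k]

lemma isDominant_specMap_of_injective {R S : Type} [CommRing R] [CommRing S] {f : R →+* S}
    (hf : Function.Injective f) : IsDominant (specMap f) :=
  ⟨(PrimeSpectrum.denseRange_comap_iff_ker_le_nilRadical f).mpr
    (((RingHom.injective_iff_ker_eq_bot f).mp hf).le.trans bot_le)⟩

/-- Elements of the local ring of `B` at a prime have a common denominator outside the prime. -/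
lemma exists_notMem_forall_mul_mem {B : Subring k} (P : Ideal B) [P.IsPrime] {H : Set k}
    (hfin : H.Finite) (hH : ∀ h ∈ H, h ∈ (LocalSubring.ofPrime B P).toSubring) :
    ∃ b ∉ P, ∀ h ∈ H, (b : k) * h ∈ B := by
  induction H, hfin using Set.Finite.induction_on with
  | empty => exact ⟨1, fun h ↦ Ideal.IsPrime.ne_top ‹_› ((Ideal.eq_top_iff_one _).mpr h), by simp⟩
  | @insert a t _ _ ih =>
    obtain ⟨b, hb, hbt⟩ := ih fun h hh ↦ hH h (Set.mem_insert_of_mem _ hh)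
    obtain ⟨⟨n, d⟩, hn⟩ := IsLocalization.surj P.primeCompl
      (⟨a, hH a (Set.mem_insert _ _)⟩ : (LocalSubring.ofPrime B P).toSubring)
    have hn' : a * (d : B) = (n : k) := congrArg Subtype.val hn
    refine ⟨d * b, fun h ↦ (Ideal.IsPrime.mem_or_mem ‹_› h).elim d.2 hb, ?_⟩
    rintro h (rfl | hh)
    · have : ((d * b : B) : k) * h = b * n := by rw [← hn']; push_cast; ring
      rw [this]
      exact mul_mem b.2 n.2
    · have : ((d * b : B) : k) * h = (d : B) * (b * h) := by push_cast; ring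
      rw [this]
      exact mul_mem (d : B).2 (hbt h hh)

lemma exists_ringHom_comp_eq {A E L : Type} [CommRing A] [CommRing E] [CommRing L] [Algebra A E]
    {H : Set E} (hH : Algebra.adjoin A H = ⊤) {τ : L →+* k} (hτ : Function.Injective τ)
    (χ : E →+* k) (hA : ∀ a, χ (algebraMap A E a) ∈ τ.range) (hχ : ∀ h ∈ H, χ h ∈ τ.range) :
    ∃ σ : E →+* L, τ.comp σ = χ := by
  have hall (x : E) : χ x ∈ τ.range := by
    have hx : x ∈ Algebra.adjoin A H := hH ▸ Algebra.mem_top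
    induction hx using Algebra.adjoin_induction with
    | mem g hg => exact hχ g hg
    | algebraMap c => exact hA c
    | add a b _ _ ha hb => rw [map_add]; exact add_mem ha hb
    | mul a b _ _ ha hb => rw [map_mul]; exact mul_mem ha hb
  let e : L ≃+* τ.range := RingEquiv.ofBijective τ.rangeRestrict
    ⟨fun a b h ↦ hτ (congrArg Subtype.val h), τ.rangeRestrict_surjective⟩
  refine ⟨e.symm.toRingHom.comp (χ.codRestrict τ.range hall), RingHom.ext fun x ↦ ?_⟩
  exact congrArg Subtype.val (e.apply_symm_apply (χ.codRestrict τ.range hall x))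

variable {A B : Subring k} (hAB : A ≤ B) {Y : Scheme} (s : Y ⟶ Spec (CommRingCat.of A))
  [IsSeparated s] {ι : Type} {E : ι → Type} [∀ i, CommRing (E i)] [∀ i, Algebra A (E i)]
  (j : ∀ i, Spec (CommRingCat.of (E i)) ⟶ Y)
  (H : ∀ i, Set (E i)) (hfin : ∀ i, (H i).Finite) (hH : ∀ i, Algebra.adjoin A (H i) = ⊤)
  (hjs : ∀ i, j i ≫ s = specMap (algebraMap A (E i)))

include hfin hH hjs in
/-- A `k`-point which is integral over all local rings of `B` extends to a `B`-point. -/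
lemma exists_extend_of_isIntegralPoint {y : Spec (CommRingCat.of k) ⟶ Y}
    (hys : y ≫ s = specMap A.subtype)
    (hy : ∀ R : Subring k, B ≤ R → IsLocalRing R → IsIntegralPoint R j H y) :
    ∃ q : Spec (CommRingCat.of B) ⟶ Y, q ≫ s = specMap (Subring.inclusion hAB) ∧
      specMap B.subtype ≫ q = y := by
  have hloc (x : PrimeSpectrum B) : ∃ b ∉ x.asIdeal, ∃ (τ : Localization.Away b →+* k)
      (g : Spec (CommRingCat.of (Localization.Away b)) ⟶ Y), Function.Injective τ ∧
      τ.comp (algebraMap B (Localization.Away b)) = B.subtype ∧ specMap τ ≫ g = y ∧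
      g ≫ s = specMap (algebraMap B (Localization.Away b)) ≫ specMap (Subring.inclusion hAB) := by
    obtain ⟨i, χ, rfl, hχ⟩ := hy (LocalSubring.ofPrime B x.asIdeal).toSubring
      (LocalSubring.le_ofPrime B x.asIdeal) inferInstance
    obtain ⟨b, hb, hbH⟩ := exists_notMem_forall_mul_mem x.asIdeal ((hfin i).image χ)
      (by rintro _ ⟨h, hh, rfl⟩; exact hχ h hh)
    have hb0 : (b : k) ≠ 0 := fun h ↦ hb (by
      rw [show b = 0 from Subtype.ext h]; exact zero_mem _)
    let τ : Localization.Away b →+* k :=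
      IsLocalization.Away.lift b (g := B.subtype) (isUnit_iff_ne_zero.mpr hb0)
    have hτB (a : B) : τ (algebraMap B _ a) = a := IsLocalization.Away.lift_eq _ _ _
    have hτb : τ (IsLocalization.Away.invSelf b) * b = 1 := by
      rw [← hτB b, ← map_mul, mul_comm, IsLocalization.Away.mul_invSelf, map_one]
    have hτ : Function.Injective τ := by
      rw [injective_iff_map_eq_zero]
      intro z hz
      obtain ⟨⟨n, ⟨_, N, rfl⟩⟩, hn⟩ := IsLocalization.surj (Submonoid.powers b) z
      have h1 := congrArg τ hn
      rw [map_mul, hz, zero_mul, hτB] at h1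
      have h2 : n = 0 := Subtype.ext h1.symm
      rw [h2, map_zero] at hn
      exact (IsUnit.mul_left_eq_zero
        (IsLocalization.map_units (M := Submonoid.powers b) _ ⟨_, N, rfl⟩)).mp hn
    have hχA : χ.comp (algebraMap A (E i)) = A.subtype := by
      apply specMap_injective
      rw [specMap_comp, ← hys, Category.assoc, hjs]
    obtain ⟨σ, hσ⟩ := exists_ringHom_comp_eq (hH i) hτ χ
      (fun a ↦ ⟨algebraMap B _ (Subring.inclusion hAB a), by
        rw [hτB]; exact (DFunLike.congr_fun hχA a).symm⟩)
      (fun h hh ↦ ⟨IsLocalization.Away.invSelf b *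
          algebraMap B _ ⟨_, hbH (χ h) ⟨h, hh, rfl⟩⟩, by
        rw [map_mul, hτB, ← mul_assoc, hτb, one_mul]⟩)
    refine ⟨b, hb, τ, specMap σ ≫ j i, hτ, RingHom.ext hτB, ?_, ?_⟩
    · rw [← Category.assoc, ← specMap_comp, hσ]
    · rw [Category.assoc, hjs, ← specMap_comp, ← specMap_comp]
      congr 1
      refine RingHom.ext fun a ↦ hτ ?_
      have h1 : τ (σ (algebraMap A (E i) a)) = χ (algebraMap A (E i) a) :=
        DFunLike.congr_fun hσ _
      rw [RingHom.comp_apply, RingHom.comp_apply, h1, hτB]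
      exact DFunLike.congr_fun hχA a
  choose b hb τ g hτ hτB hg hgs using hloc
  have hspan : Ideal.span (Set.range b) = ⊤ := by
    by_contra h
    obtain ⟨M, hM, hle⟩ := Ideal.exists_le_maximal _ h
    exact hb ⟨M, hM.isPrime⟩ (hle (Ideal.subset_span ⟨_, rfl⟩))
  let 𝒰 : (Spec (CommRingCat.of B)).OpenCover :=
    (Scheme.affineOpenCoverOfSpanRangeEqTop (R := CommRingCat.of B) b hspan).openCover
  have hdom (W : Scheme) (f : W ⟶ Spec (CommRingCat.of B)) [IsOpenImmersion f]
      (z : Spec (CommRingCat.of k) ⟶ W) (hz : z ≫ f = specMap B.subtype) : IsDominant z := by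
    have : IsDominant (z ≫ f) := hz ▸ isDominant_specMap_of_injective B.subtype_injective
    exact IsDominant.of_comp_of_isOpenImmersion z f
  have hz (x) : specMap (τ x) ≫ specMap (algebraMap B (Localization.Away (b x))) =
      specMap B.subtype := by
    rw [← specMap_comp, hτB]
  let u (x : PrimeSpectrum B) := specMap (algebraMap B (Localization.Away (b x)))
  have hu (x) : IsOpenImmersion (u x) :=
    Scheme.isOpenImmersion_SpecMap_localizationAway (R := CommRingCat.of B) (b x)
  have hcompat (x x' : PrimeSpectrum B) : pullback.fst (u x) (u x') ≫ g x =
      pullback.snd (u x) (u x') ≫ g x' := by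
    have hred : IsReduced (pullback (u x) (u x')) :=
      isReduced_of_isOpenImmersion (pullback.fst (u x) (u x') ≫ u x)
    have : IsDominant (pullback.lift (f := u x) (g := u x') (specMap (τ x)) (specMap (τ x'))
        ((hz x).trans (hz x').symm)) :=
      hdom _ (pullback.fst (u x) (u x') ≫ u x) _ (by rw [pullback.lift_fst_assoc]; exact hz x)
    refine ext_of_isDominant_of_isSeparated s ?_ (pullback.lift (f := u x) (g := u x')
      (specMap (τ x)) (specMap (τ x')) ((hz x).trans (hz x').symm)) ?_
    · rw [Category.assoc, Category.assoc, hgs, hgs]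
      exact pullback.condition_assoc _
    · rw [pullback.lift_fst_assoc, pullback.lift_snd_assoc, hg, hg]
  let q := 𝒰.glueMorphisms g hcompat
  have hq (x) : specMap (algebraMap B (Localization.Away (b x))) ≫ q = g x :=
    𝒰.ι_glueMorphisms g hcompat x
  refine ⟨q, 𝒰.hom_ext _ _ fun x ↦ ?_, ?_⟩
  · exact (Category.assoc _ _ _).symm.trans ((congrArg (· ≫ s) (hq x)).trans (hgs x))
  · obtain ⟨x⟩ : Nonempty (PrimeSpectrum B) := inferInstance
    rw [← hz x, Category.assoc, hq, hg]

include hfin hH hjs in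
lemma finite_setOf_isIntegralPoint
    (hB : {q : Spec (CommRingCat.of B) ⟶ Y | q ≫ s = specMap (Subring.inclusion hAB)}.Finite) :
    {y : Spec (CommRingCat.of k) ⟶ Y | y ≫ s = specMap A.subtype ∧
      ∀ R : Subring k, B ≤ R → IsLocalRing R → IsIntegralPoint R j H y}.Finite :=
  (hB.image (specMap B.subtype ≫ ·)).subset fun y ⟨hys, hy⟩ ↦ by
    obtain ⟨q, hq, rfl⟩ := exists_extend_of_isIntegralPoint hAB s j H hfin hH hjs hys hy
    exact ⟨q, hq, rfl⟩

end Descent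

section ArithmeticHyperbolicity

variable {k : Type} [Field k]

lemma finiteType_closure {C : Set k} (hC : C.Finite) :
    Algebra.FiniteType ℤ (Subring.closure C) := by
  have h1 : Algebra.FiniteType ℤ (Algebra.adjoin ℤ C) := by
    rw [← Subalgebra.fg_iff_finiteType, ← hC.coe_toFinset]
    exact Subalgebra.fg_adjoin_finset _
  have h2 (x : k) : x ∈ Algebra.adjoin ℤ C ↔ x ∈ Subring.closure C := by
    rw [Algebra.adjoin_int]; rfl
  let f : Algebra.adjoin ℤ C →+* Subring.closure C :=
    (Algebra.adjoin ℤ C).val.toRingHom.codRestrict _ fun x ↦ (h2 x).mp x.2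
  exact h1.of_surjective f.toIntAlgHom fun x ↦ ⟨⟨x.1, (h2 x).mpr x.2⟩, rfl⟩

lemma exists_finite_forall_le {A : Subring k} (hA : Algebra.FiniteType ℤ A) :
    ∃ C : Set k, C.Finite ∧ ∀ R : Subring k, C ⊆ R → A ≤ R := by
  obtain ⟨s, hs⟩ := hA.out
  refine ⟨Subtype.val '' (s : Set A), s.finite_toSet.image _, fun R hR a ha ↦ ?_⟩
  have hx : (⟨a, ha⟩ : A) ∈ Algebra.adjoin ℤ (s : Set A) := hs ▸ Algebra.mem_top
  refine Algebra.adjoin_induction (p := fun (x : A) _ ↦ (x : k) ∈ R) ?_ ?_ ?_ ?_ hx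
  · exact fun x hx ↦ hR ⟨x, hx, rfl⟩
  · exact fun r ↦ by simp
  · exact fun x y _ _ hx hy ↦ by simpa using add_mem hx hy
  · exact fun x y _ _ hx hy ↦ by simpa using mul_mem hx hy

/-- A notion of integrality with respect to local subrings of `k` for the `k`-points of `X` for
which integrality of points of affine `k`-schemes is preserved, while `X` has only finitely many
integral points. -/
def HasFinitenessOfIntegralPoints {X : Scheme} (sX : X ⟶ Spec (CommRingCat.of k)) : Prop :=
  ∃ I : Subring k → (Spec (CommRingCat.of k) ⟶ X) → Prop,
    (∀ (S : Type) [CommRing S] [Algebra k S] (G : Set S) (_ : Algebra.adjoin k G = ⊤)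
      (ψ : Spec (CommRingCat.of S) ⟶ X), ∀ᶠ R : Subring k in largeSubrings k, IsLocalRing R →
        ∀ χ : S →ₐ[k] k, (∀ g ∈ G, χ g ∈ R) → I R (specMap χ.toRingHom ≫ ψ)) ∧
    ∀ Q : Set (Spec (CommRingCat.of k) ⟶ X), (∀ y ∈ Q, y ≫ sX = 𝟙 _) →
      (∀ᶠ R : Subring k in largeSubrings k, IsLocalRing R → ∀ y ∈ Q, I R y) → Q.Finite

lemma hasFinitenessOfIntegralPoints (X : Scheme) (sX : X ⟶ Spec (CommRingCat.of k))
    (harith : ∃ (A : Subring k) (_ : Algebra.FiniteType ℤ A)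
      (𝒳 : Scheme) (s𝒳 : 𝒳 ⟶ Spec (CommRingCat.of A))
      (_ : LocallyOfFiniteType s𝒳) (_ : QuasiCompact s𝒳) (_ : IsSeparated s𝒳)
      (iso : pullback s𝒳 (Spec.map (CommRingCat.ofHom A.subtype)) ≅ X),
      iso.hom ≫ sX = pullback.snd s𝒳 (Spec.map (CommRingCat.ofHom A.subtype)) ∧
      ∀ (A' : Subring k) (hAA' : A ≤ A'), Algebra.FiniteType ℤ A' →
        {q : Spec (CommRingCat.of A') ⟶ 𝒳 |
          q ≫ s𝒳 = Spec.map (CommRingCat.ofHom (Subring.inclusion hAA'))}.Finite) :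
    HasFinitenessOfIntegralPoints sX := by
  obtain ⟨A, hA, 𝒳, s, _, _, _, iso, hiso, hfin⟩ := harith
  obtain ⟨ι, _, E, _, _, j, _, H, hHfin, hH, hj, hjs⟩ := exists_finite_affine_cover s
  let pr : X ⟶ 𝒳 := iso.inv ≫ pullback.fst _ _
  have hsX : sX = iso.inv ≫ pullback.snd s (specMap A.subtype) := by
    rw [← hiso, Iso.inv_hom_id_assoc]
  have hpr : pr ≫ s = sX ≫ specMap A.subtype := by
    rw [hsX, Category.assoc, Category.assoc, pullback.condition]
  refine ⟨fun R y ↦ IsIntegralPoint R j H (y ≫ pr), ?_, ?_⟩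
  · intro S _ _ G hG ψ
    filter_upwards [eventually_isIntegralPoint hG j hj H hHfin (ψ ≫ pr)] with R h hR χ hχ
    rw [Category.assoc]
    exact h hR χ hχ
  · intro Q hQ hQint
    obtain ⟨C, hC, hCint⟩ := exists_finite_of_eventually_largeSubrings hQint
    obtain ⟨C', hC', hCA⟩ := exists_finite_forall_le hA
    have hAB : A ≤ Subring.closure (C ∪ C') :=
      hCA _ (Set.subset_union_right.trans Subring.subset_closure)
    have hf := finite_setOf_isIntegralPoint hAB s j H hHfin hH hjs
      (hfin _ hAB (finiteType_closure (hC.union hC')))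
    refine Set.Finite.of_finite_image (f := (· ≫ pr)) (hf.subset ?_) ?_
    · rintro _ ⟨y, hy, rfl⟩
      refine ⟨?_, fun R hBR hR ↦ hCint R ?_ hR y hy⟩
      · rw [Category.assoc, hpr, ← Category.assoc, hQ y hy, Category.id_comp]
      · exact Set.subset_union_left.trans (Subring.subset_closure.trans hBR)
    · intro y hy y' hy' h
      rw [← cancel_mono iso.inv]
      refine pullback.hom_ext ?_ ?_
      · simpa [pr] using h
      · rw [Category.assoc, Category.assoc, ← hsX, hQ y hy, hQ y' hy']

end ArithmeticHyperbolicity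

section GroupMultiplicative

variable {k : Type} [Field k]

/-- Two morphisms to a separated scheme that agree on a dense set of `k`-points are equal. -/
lemma eq_of_forall_specMap_comp_eq {S : Type} [CommRing S] [_root_.IsReduced S] {ι : Type}
    (χ : ι → S →+* k) (hχ : ∀ a, (∀ i, χ i a = 0) → a = 0) {X Z : Scheme} (s : X ⟶ Z)
    [IsSeparated s] {f g : Spec (CommRingCat.of S) ⟶ X} (hs : f ≫ s = g ≫ s)
    (h : ∀ i, specMap (χ i) ≫ f = specMap (χ i) ≫ g) : f = g := by
  let z : (∐ fun _ : ι ↦ Spec (CommRingCat.of k)) ⟶ Spec (CommRingCat.of S) :=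
    Sigma.desc fun i ↦ specMap (χ i)
  have hz (i) : Sigma.ι (fun _ : ι ↦ Spec (CommRingCat.of k)) i ≫ z = specMap (χ i) :=
    Sigma.ι_desc _ _
  have : IsDominant z := by
    refine ⟨PrimeSpectrum.isTopologicalBasis_basic_opens.dense_iff.mpr ?_⟩
    rintro _ ⟨a, rfl⟩ ⟨x, hx⟩
    have ha : a ≠ 0 := by
      rintro rfl
      exact hx (zero_mem x.asIdeal)
    obtain ⟨i, hi⟩ : ∃ i, χ i a ≠ 0 := by
      by_contra! hcon
      exact ha (hχ a hcon)
    let x₀ : Spec (CommRingCat.of k) := (⊥ : PrimeSpectrum k)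
    refine ⟨specMap (χ i) x₀, ?_, ?_⟩
    · change a ∉ ((⊥ : PrimeSpectrum k).comap (χ i)).asIdeal
      rw [PrimeSpectrum.comap_asIdeal, Ideal.mem_comap]
      exact hi
    · rw [← hz, Scheme.Hom.comp_apply]
      exact Set.mem_range_self _
  refine ext_of_isDominant_of_isSeparated s hs z (Sigma.hom_ext _ _ fun i ↦ ?_)
  rw [← Category.assoc, ← Category.assoc, hz, h]

/-- The `k`-point of the multiplicative group given by a unit. -/
noncomputable def laurentEval (u : kˣ) : LaurentPolynomial k →ₐ[k] k :=
  AddMonoidAlgebra.lift k k ℤ ((Units.coeHom k).comp (zpowersHom kˣ u))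

lemma laurentEval_T (u : kˣ) (n : ℤ) : laurentEval u (LaurentPolynomial.T n) = (u : k) ^ n := by
  rw [laurentEval, LaurentPolynomial.T, AddMonoidAlgebra.lift_single, one_smul]
  simp

lemma laurentEval_toLaurent (u : kˣ) (p : Polynomial k) :
    laurentEval u (Polynomial.toLaurent p) = p.eval (u : k) := by
  have : ((laurentEval u).comp Polynomial.toLaurentAlg) = Polynomial.aeval (u : k) := by
    ext
    simp [laurentEval_T]
  have h := DFunLike.congr_fun this p
  rw [Polynomial.coe_aeval_eq_eval] at h
  exact h

lemma adjoin_laurent : Algebra.adjoin k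
    ({LaurentPolynomial.T 1, LaurentPolynomial.T (-1)} : Set (LaurentPolynomial k)) = ⊤ := by
  refine eq_top_iff.mpr fun f _ ↦ ?_
  have hT (n : ℤ) : (LaurentPolynomial.T n : LaurentPolynomial k) ∈ Algebra.adjoin k
      ({LaurentPolynomial.T 1, LaurentPolynomial.T (-1)} : Set (LaurentPolynomial k)) := by
    obtain ⟨m, rfl | rfl⟩ := n.eq_nat_or_neg
    · have := pow_mem (Algebra.subset_adjoin (R := k)
        (Set.mem_insert (LaurentPolynomial.T 1 : LaurentPolynomial k) {LaurentPolynomial.T (-1)})) m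
      rwa [LaurentPolynomial.T_pow, mul_one] at this
    · have := pow_mem (Algebra.subset_adjoin (R := k) (Set.mem_insert_of_mem
        (LaurentPolynomial.T 1 : LaurentPolynomial k) (Set.mem_singleton
          (LaurentPolynomial.T (-1))))) m
      rwa [LaurentPolynomial.T_pow, mul_neg_one] at this
  induction f using LaurentPolynomial.induction_on' with
  | add p q hp hq => exact add_mem (hp trivial) (hq trivial)
  | C_mul_T n a =>
    rw [← LaurentPolynomial.smul_eq_C_mul]
    exact Subalgebra.smul_mem _ (hT n) a

theorem exists_eq_of_multiplicative [CharZero k] {X : Scheme} {sX : X ⟶ Spec (CommRingCat.of k)}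
    [IsSeparated sX] (hX : HasFinitenessOfIntegralPoints sX)
    (φ : Spec (CommRingCat.of (LaurentPolynomial k)) ⟶ X)
    (hφ : φ ≫ sX = specMap (algebraMap k (LaurentPolynomial k))) :
    ∃ x : Spec (CommRingCat.of k) ⟶ X, φ = specMap (algebraMap k (LaurentPolynomial k)) ≫ x := by
  obtain ⟨I, hI, hfin⟩ := hX
  let χ (n : ℕ) : LaurentPolynomial k →ₐ[k] k := laurentEval (Units.mk0 2 two_ne_zero ^ n)
  have hQ : (Set.range fun n ↦ specMap (χ n).toRingHom ≫ φ).Finite := by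
    refine hfin _ ?_ ?_
    · rintro _ ⟨n, rfl⟩
      rw [Category.assoc, hφ, ← specMap_comp, (χ n).toRingHom_eq_coe, AlgHom.comp_algebraMap]
      exact Spec.map_id _
    · filter_upwards [hI _ _ adjoin_laurent φ, eventually_mem_largeSubrings (2 : k),
        eventually_mem_largeSubrings (2⁻¹ : k)] with R hR h2 h2' hloc
      rintro _ ⟨n, rfl⟩
      refine hR hloc _ ?_
      rintro _ (rfl | rfl)
      · simpa [χ, laurentEval_T] using pow_mem h2 n
      · simpa [χ, laurentEval_T] using pow_mem h2' n
  obtain ⟨x, hx⟩ : ∃ x, ((fun n ↦ specMap (χ n).toRingHom ≫ φ) ⁻¹' {x}).Infinite := by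
    by_contra! hcon
    refine Set.infinite_univ (α := ℕ) ((hQ.preimage' fun x _ ↦ hcon x).subset ?_)
    exact fun n _ ↦ Set.mem_range_self n
  let N := (fun n ↦ specMap (χ n).toRingHom ≫ φ) ⁻¹' {x}
  have : Infinite N := hx.to_subtype
  have hxn (n : N) : specMap (χ n).toRingHom ≫ φ = x := n.2
  have hkk (n) : specMap (χ n).toRingHom ≫ specMap (algebraMap k (LaurentPolynomial k)) = 𝟙 _ := by
    rw [← specMap_comp, (χ n).toRingHom_eq_coe, AlgHom.comp_algebraMap]
    exact Spec.map_id _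
  have hxs : x ≫ sX = 𝟙 _ := by
    obtain ⟨n⟩ : Nonempty N := inferInstance
    rw [← hxn n, Category.assoc, hφ, hkk]
  refine ⟨x, eq_of_forall_specMap_comp_eq (fun n : N ↦ (χ n).toRingHom) ?_ sX ?_ ?_⟩
  · intro f hf
    obtain ⟨m, p, hp⟩ := f.exists_T_pow
    have hp0 : p = 0 := by
      refine Polynomial.eq_zero_of_infinite_isRoot p ((Set.infinite_range_of_injective
        (f := fun n : N ↦ (2 : k) ^ (n : ℕ)) ?_).mono ?_)
      · intro a b hab
        refine Subtype.ext (Nat.pow_right_injective le_rfl (Nat.cast_injective (R := k) ?_))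
        simpa using hab
      · rintro _ ⟨n, rfl⟩
        have h1 := congrArg (χ n) hp
        have h2 : χ n f = 0 := hf n
        rw [map_mul, h2, zero_mul, laurentEval_toLaurent] at h1
        simpa using h1
    rw [hp0, map_zero] at hp
    exact (LaurentPolynomial.isUnit_T (m : ℤ)).mul_left_eq_zero.mp hp.symm
  · rw [hφ, Category.assoc, hxs, Category.comp_id]
  · intro n
    rw [hxn, ← Category.assoc, hkk, Category.id_comp]

end GroupMultiplicative

section AbelianVariety

variable {k : Type} [Field k]

lemma adjoin_tensorProduct {D D' : Type} [CommRing D] [Algebra k D] [CommRing D'] [Algebra k D']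
    {G : Set D} {G' : Set D'} (hG : Algebra.adjoin k G = ⊤) (hG' : Algebra.adjoin k G' = ⊤) :
    Algebra.adjoin k ((Algebra.TensorProduct.includeLeft : D →ₐ[k] D ⊗[k] D') '' G ∪
      (Algebra.TensorProduct.includeRight : D' →ₐ[k] D ⊗[k] D') '' G') = ⊤ := by
  rw [Algebra.adjoin_union, ← AlgHom.map_adjoin, ← AlgHom.map_adjoin, hG, hG']
  refine eq_top_iff.mpr fun x _ ↦ ?_
  induction x using TensorProduct.induction_on with
  | zero => exact zero_mem _
  | add x y hx hy => exact add_mem (hx trivial) (hy trivial)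
  | tmul a b =>
    rw [show a ⊗ₜ[k] b = (a ⊗ₜ 1) * (1 ⊗ₜ b) by simp]
    exact mul_mem
      (Algebra.mem_sup_left (S := Subalgebra.map _ _) (T := Subalgebra.map _ _) ⟨a, trivial, rfl⟩)
      (Algebra.mem_sup_right (S := Subalgebra.map _ _) (T := Subalgebra.map _ _) ⟨b, trivial, rfl⟩)

variable (Ab : AbelianVarietyOver (Spec (CommRingCat.of k)))

/-- The product of two `T`-points of an abelian variety. -/
noncomputable def AbelianVarietyOver.mulMap {T : Scheme} (a b : T ⟶ Ab.Ab)
    (h : a ≫ Ab.s = b ≫ Ab.s) : T ⟶ Ab.Ab :=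
  pullback.lift a b h ≫ Ab.mul

lemma AbelianVarietyOver.comp_mulMap {T T' : Scheme} (t : T' ⟶ T) (a b : T ⟶ Ab.Ab)
    (h : a ≫ Ab.s = b ≫ Ab.s) :
    t ≫ Ab.mulMap a b h = Ab.mulMap (t ≫ a) (t ≫ b) (by rw [Category.assoc, h, Category.assoc]) := by
  rw [mulMap, ← Category.assoc, mulMap]
  congr 1
  apply pullback.hom_ext
  · rw [Category.assoc, pullback.lift_fst, pullback.lift_fst]
  · rw [Category.assoc, pullback.lift_snd, pullback.lift_snd]

lemma AbelianVarietyOver.mulMap_comp {T : Scheme} (a b : T ⟶ Ab.Ab)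
    (h : a ≫ Ab.s = b ≫ Ab.s) : Ab.mulMap a b h ≫ Ab.s = a ≫ Ab.s := by
  rw [mulMap, Category.assoc, Ab.mul_over, pullback.lift_fst_assoc]

/-- The type of `k`-points of an abelian variety over `k`. -/
abbrev AbelianVarietyOver.Point : Type := {P : Spec (CommRingCat.of k) ⟶ Ab.Ab // P ≫ Ab.s = 𝟙 _}

/-- The sum of two `k`-points of an abelian variety. -/
noncomputable def AbelianVarietyOver.add (P Q : Ab.Point) : Ab.Point :=
  ⟨Ab.mulMap P.1 Q.1 (P.2.trans Q.2.symm), by rw [mulMap_comp, P.2]⟩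

section MulChart

variable {Ab} {D D' T : Type} [CommRing D] [Algebra k D] [CommRing D'] [Algebra k D']
  [CommRing T] [Algebra k T]
  {j : Spec (CommRingCat.of D) ⟶ Ab.Ab} {j' : Spec (CommRingCat.of D') ⟶ Ab.Ab}
  (hj : j ≫ Ab.s = specMap (algebraMap k D)) (hj' : j' ≫ Ab.s = specMap (algebraMap k D'))

include hj in
lemma specMap_comp_chart (f : D →ₐ[k] T) :
    (specMap f.toRingHom ≫ j) ≫ Ab.s = specMap (algebraMap k T) := by
  rw [Category.assoc, hj, ← specMap_comp]
  congr 1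
  exact f.comp_algebraMap

/-- The group law in affine charts. -/
noncomputable def mulChart : Spec (CommRingCat.of (D ⊗[k] D')) ⟶ Ab.Ab :=
  Ab.mulMap (specMap (Algebra.TensorProduct.includeLeft : D →ₐ[k] D ⊗[k] D').toRingHom ≫ j)
    (specMap (Algebra.TensorProduct.includeRight : D' →ₐ[k] D ⊗[k] D').toRingHom ≫ j')
    ((specMap_comp_chart hj _).trans (specMap_comp_chart hj' _).symm)

lemma specMap_comp_mulChart (f : D →ₐ[k] T) (f' : D' →ₐ[k] T) :
    specMap (Algebra.TensorProduct.productMap f f').toRingHom ≫ mulChart hj hj' =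
      Ab.mulMap (specMap f.toRingHom ≫ j) (specMap f'.toRingHom ≫ j')
        ((specMap_comp_chart hj _).trans (specMap_comp_chart hj' _).symm) := by
  rw [mulChart, Ab.comp_mulMap]
  congr 1
  · rw [← Category.assoc, ← specMap_comp]
    congr 2
    exact RingHom.ext fun x ↦ by simp
  · rw [← Category.assoc, ← specMap_comp]
    congr 2
    exact RingHom.ext fun x ↦ by simp

include hj in
lemma exists_algHom_of_comp_eq_id {χ : D →+* k} (h : (specMap χ ≫ j) ≫ Ab.s = 𝟙 _) :
    ∃ χ' : D →ₐ[k] k, χ'.toRingHom = χ := by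
  rw [Category.assoc, hj, ← specMap_comp] at h
  have h' : χ.comp (algebraMap k D) = RingHom.id k := by
    apply specMap_injective
    rw [h]
    exact (Spec.map_id _).symm
  exact ⟨{ χ with commutes' := fun r ↦ DFunLike.congr_fun h' r }, rfl⟩

end MulChart

variable {ι : Type} [Finite ι] {D : ι → Type} [∀ i, CommRing (D i)] [∀ i, Algebra k (D i)]
  (j : ∀ i, Spec (CommRingCat.of (D i)) ⟶ Ab.Ab) (G : ∀ i, Set (D i))
  (hfin : ∀ i, (G i).Finite) (hG : ∀ i, Algebra.adjoin k (G i) = ⊤)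
  (hjs : ∀ i, j i ≫ Ab.s = specMap (algebraMap k (D i)))

include hfin hG hjs in
lemma eventually_isIntegralPoint_add [∀ i, IsOpenImmersion (j i)]
    (hj : ∀ y, ∃ i, y ∈ Set.range (j i)) :
    ∀ᶠ R : Subring k in largeSubrings k, IsLocalRing R → ∀ P Q : Ab.Point,
      IsIntegralPoint R j G P.1 → IsIntegralPoint R j G Q.1 →
      IsIntegralPoint R j G (Ab.add P Q).1 := by
  have h := Filter.eventually_all.mpr fun p : ι × ι ↦
    eventually_isIntegralPoint (adjoin_tensorProduct (hG p.1) (hG p.2)) j hj G hfin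
      (mulChart (hjs p.1) (hjs p.2))
  filter_upwards [h] with R h hR P Q ⟨i, χ, hP, hχ⟩ ⟨i', χ', hQ, hχ'⟩
  obtain ⟨χ, rfl⟩ := exists_algHom_of_comp_eq_id (hjs i) (hP ▸ P.2)
  obtain ⟨χ', rfl⟩ := exists_algHom_of_comp_eq_id (hjs i') (hQ ▸ Q.2)
  have := h (i, i') hR (Algebra.TensorProduct.productMap χ χ') ?_
  · rw [specMap_comp_mulChart] at this
    simpa only [AbelianVarietyOver.add, hP, hQ] using this
  · rintro _ (⟨g, hg, rfl⟩ | ⟨g, hg, rfl⟩)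
    · simpa using hχ g hg
    · simpa using hχ' g hg

include hG hjs in
lemma eventually_forall_isIntegralPoint {X : Scheme} (φ : Ab.Ab ⟶ X)
    (I : Subring k → (Spec (CommRingCat.of k) ⟶ X) → Prop)
    (hI : ∀ (S : Type) [CommRing S] [Algebra k S] (G : Set S) (_ : Algebra.adjoin k G = ⊤)
      (ψ : Spec (CommRingCat.of S) ⟶ X), ∀ᶠ R : Subring k in largeSubrings k, IsLocalRing R →
        ∀ χ : S →ₐ[k] k, (∀ g ∈ G, χ g ∈ R) → I R (specMap χ.toRingHom ≫ ψ)) :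
    ∀ᶠ R : Subring k in largeSubrings k, IsLocalRing R → ∀ P : Ab.Point,
      IsIntegralPoint R j G P.1 → I R (P.1 ≫ φ) := by
  have h := Filter.eventually_all.mpr fun i : ι ↦ hI (D i) (G i) (hG i) (j i ≫ φ)
  filter_upwards [h] with R h hR P ⟨i, χ, hP, hχ⟩
  obtain ⟨χ, rfl⟩ := exists_algHom_of_comp_eq_id (hjs i) (hP ▸ P.2)
  rw [hP, Category.assoc]
  exact h i hR χ hχ

omit [Finite ι] [∀ i, Algebra k (D i)] in
include hfin in
lemma eventually_isIntegralPoint_point [∀ i, IsOpenImmersion (j i)]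
    (hj : ∀ y, ∃ i, y ∈ Set.range (j i)) (P : Spec (CommRingCat.of k) ⟶ Ab.Ab) :
    ∀ᶠ R : Subring k in largeSubrings k, IsLocalRing R → IsIntegralPoint R j G P := by
  have hk : Algebra.adjoin k (∅ : Set k) = ⊤ := Subsingleton.elim _ _
  filter_upwards [eventually_isIntegralPoint hk j hj G hfin P] with R h hR
  have := h hR (AlgHom.id k k) (by simp)
  rwa [show specMap (AlgHom.id k k).toRingHom = 𝟙 _ from Spec.map_id _, Category.id_comp] at this

end AbelianVariety

/-- If `Γ` is a set of `k`-points of an abelian variety generated under addition by one point,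
its image in a variety with finitely many integral points is finite. -/
theorem finite_of_add_closed {k : Type} [Field k] (Ab : AbelianVarietyOver (Spec (CommRingCat.of k)))
    {X : Scheme} {sX : X ⟶ Spec (CommRingCat.of k)} (hX : HasFinitenessOfIntegralPoints sX)
    (φ : Ab.Ab ⟶ X) (hφ : φ ≫ sX = Ab.s) (P : Ab.Point) (Γ : Set Ab.Point)
    (hΓ : ∀ p : Ab.Point → Prop, p P → (∀ Q Q', p Q → p Q' → p (Ab.add Q Q')) → ∀ Q ∈ Γ, p Q) :
    ((fun Q : Ab.Point ↦ Q.1 ≫ φ) '' Γ).Finite := by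
  obtain ⟨I, hI, hfin⟩ := hX
  have := Ab.proper
  obtain ⟨ι, _, D, _, _, j, _, G, hGfin, hG, hj, hjs⟩ := exists_finite_affine_cover Ab.s
  refine hfin _ ?_ ?_
  · rintro _ ⟨Q, -, rfl⟩
    rw [Category.assoc, hφ, Q.2]
  · filter_upwards [eventually_isIntegralPoint_add Ab j G hGfin hG hjs hj,
      eventually_forall_isIntegralPoint Ab j G hG hjs φ I hI,
      eventually_isIntegralPoint_point Ab j G hGfin hj P.1] with R hadd hIφ hP hR
    rintro _ ⟨Q, hQ, rfl⟩
    exact hIφ hR Q (hΓ (fun Q ↦ IsIntegralPoint R j G Q.1) (hP hR) (hadd hR) Q hQ)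

section EtaleCoordinates

open Polynomial

variable {k : Type} [Field k] {d : ℕ} {D : Type} [CommRing D] [Algebra k D]
  [Algebra (MvPolynomial (Fin d) k) D] [IsScalarTower k (MvPolynomial (Fin d) k) D]

/-- The coordinates given by an algebra structure over a polynomial ring, translated so as to
vanish at `ε`. -/
noncomputable def coordinate (ε : D →ₐ[k] k) (i : Fin d) : D :=
  algebraMap (MvPolynomial (Fin d) k) D (.X i) -
    algebraMap k D (ε (algebraMap (MvPolynomial (Fin d) k) D (.X i)))

omit [IsScalarTower k (MvPolynomial (Fin d) k) D] in
lemma apply_coordinate (ε : D →ₐ[k] k) (i : Fin d) : ε (coordinate ε i) = 0 := by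
  simp [coordinate]

omit [IsScalarTower k (MvPolynomial (Fin d) k) D] in
lemma apply_coordinate' (ε χ : D →ₐ[k] k) (i : Fin d) : χ (coordinate ε i) =
    χ (algebraMap (MvPolynomial (Fin d) k) D (.X i)) -
      ε (algebraMap (MvPolynomial (Fin d) k) D (.X i)) := by
  simp [coordinate]

lemma mk_aeval_eq (ε : D →ₐ[k] k) (y : D) (p : (MvPolynomial (Fin d) k)[X]) :
    Ideal.Quotient.mk (Ideal.span (Set.range (coordinate (d := d) ε))) (aeval y p) =
      Ideal.Quotient.mk _ (aeval y
        (p.map (ε.toRingHom.comp (algebraMap (MvPolynomial (Fin d) k) D)))) := by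
  have h : (Ideal.Quotient.mk (Ideal.span (Set.range (coordinate (d := d) ε)))).comp
      (algebraMap (MvPolynomial (Fin d) k) D) = ((Ideal.Quotient.mk _).comp
        (algebraMap k D)).comp (ε.toRingHom.comp (algebraMap (MvPolynomial (Fin d) k) D)) := by
    refine MvPolynomial.ringHom_ext (fun r ↦ ?_) fun i ↦ ?_
    · have : algebraMap (MvPolynomial (Fin d) k) D (.C r) = algebraMap k D r :=
        (IsScalarTower.algebraMap_apply k (MvPolynomial (Fin d) k) D r).symm
      simp only [RingHom.comp_apply, this]
      simp
    · refine Ideal.Quotient.eq.mpr (Ideal.subset_span ⟨i, rfl⟩)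
  rw [aeval_def, aeval_def, hom_eval₂, hom_eval₂, eval₂_map, h]

/-- Étale coordinates generate the ideal of a point, locally at this point. -/
lemma exists_mul_mem_span_coordinate
    [hD : Algebra.IsStandardEtale (MvPolynomial (Fin d) k) D] (ε : D →ₐ[k] k) :
    ∃ t : D, ε t ≠ 0 ∧
      ∀ f : D, ε f = 0 → t * f ∈ Ideal.span (Set.range (coordinate (d := d) ε)) := by
  obtain ⟨⟨P⟩⟩ := hD
  let ev : MvPolynomial (Fin d) k →+* k := ε.toRingHom.comp (algebraMap _ D)
  have hev (p : (MvPolynomial (Fin d) k)[X]) : ε (aeval P.x p) = (p.map ev).eval (ε P.x) := by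
    rw [aeval_def, Polynomial.eval_map, ← AlgHom.coe_toRingHom, hom_eval₂]
    rfl
  have hroot (p : (MvPolynomial (Fin d) k)[X]) (hp : ε (aeval P.x p) = 0) :
      ∃ q, p.map ev = (X - C (ε P.x)) * q := by
    rw [hev] at hp
    exact dvd_iff_isRoot.mpr hp
  obtain ⟨q, hq⟩ := hroot P.f (by rw [P.hasMap.1, map_zero])
  refine ⟨aeval P.x q, ?_, fun f hf ↦ ?_⟩
  · have h := P.hasMap.isUnit_derivative_f.map ε
    rw [hev, ← derivative_map, hq] at h
    have h0 : ε (aeval P.x q) = q.eval (ε P.x) := by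
      rw [← aeval_algHom_apply, coe_aeval_eq_eval]
    rw [h0]
    simpa [derivative_mul] using h.ne_zero
  · obtain ⟨p, n, hp⟩ := P.exists_mul_aeval_x_g_pow_eq_aeval_x f
    obtain ⟨r, hr⟩ := hroot p (by rw [← hp, map_mul, hf, zero_mul])
    rw [← Ideal.mul_unit_mem_iff_mem _ (P.hasMap.2.pow n), mul_assoc, hp,
      ← Ideal.Quotient.eq_zero_iff_mem, map_mul, mk_aeval_eq, hr, ← map_mul, ← map_mul,
      show q * ((X - C (ε P.x)) * r) = (X - C (ε P.x)) * q * r by ring, ← hq, map_mul, map_mul,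
      ← mk_aeval_eq, P.hasMap.1, map_zero, zero_mul]

omit [Algebra k D] [Algebra (MvPolynomial (Fin d) k) D] [IsScalarTower k (MvPolynomial (Fin d) k) D] [CommRing D] in
lemma exists_root_valuation_sub_lt_one [IsAlgClosed k] (V : ValuationSubring k) {F : k[X]}
    (hF : F.Monic) {y : k} (hy : V.valuation (F.eval y) < 1) :
    ∃ η, F.eval η = 0 ∧ V.valuation (y - η) < 1 := by
  by_contra! h
  refine hy.not_ge ?_
  rw [(IsAlgClosed.splits F).eval_eq_prod_roots_of_monic hF, map_multiset_prod, Multiset.map_map]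
  refine Multiset.one_le_prod fun c hc ↦ ?_
  obtain ⟨η, hη, rfl⟩ := Multiset.mem_map.mp hc
  exact h η (isRoot_of_mem_roots hη)

/-- Étale coordinates are local coordinates in the `V`-adic topology. -/
lemma eventually_exists_coordinate_eq [IsAlgClosed k]
    [hD : Algebra.IsStandardEtale (MvPolynomial (Fin d) k) D] (ε : D →ₐ[k] k)
    {G : Set D} (hG : G.Finite) :
    ∀ᶠ V in largeValuationSubrings k, ∀ a : Fin d → k, (∀ i, V.valuation (a i) < 1) →
      ∃ χ : D →ₐ[k] k, (∀ i, χ (coordinate ε i) = a i) ∧ IsCloseTo V G ε χ := by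
  obtain ⟨⟨P⟩⟩ := hD
  let b (a : Fin d → k) : (MvPolynomial (Fin d) k) →ₐ[k] k := MvPolynomial.aeval fun i ↦ ε (algebraMap (MvPolynomial (Fin d) k) D (.X i)) + a i
  let B (a : Fin d → k) (y : k) : (MvPolynomial (Fin d) k)[X] →ₐ[k] k := eval₂AlgHom (b a) y fun _ ↦ .all _ _
  have hb (a : Fin d → k) (i) : b a (.X i) = ε (algebraMap (MvPolynomial (Fin d) k) D (.X i)) + a i := by simp [b]
  have hb0 : (b 0).toRingHom = ε.toRingHom.comp (algebraMap (MvPolynomial (Fin d) k) D) := by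
    refine MvPolynomial.ringHom_ext (fun r ↦ ?_) fun i ↦ ?_
    · have : algebraMap (MvPolynomial (Fin d) k) D (.C r) = algebraMap k D r :=
        (IsScalarTower.algebraMap_apply k (MvPolynomial (Fin d) k) D r).symm
      simp [b, this]
    · simp [b]
  have hB (p : (MvPolynomial (Fin d) k)[X]) : B 0 (ε P.x) p = ε (aeval P.x p) := by
    have : B 0 (ε P.x) p = eval₂ (b 0).toRingHom (ε P.x) p := rfl
    rw [this, hb0, aeval_def, ← AlgHom.coe_toRingHom, hom_eval₂]
    rfl
  let H : Set (MvPolynomial (Fin d) k)[X] := {X} ∪ Set.range fun i ↦ C (.X i)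
  have hH : Algebra.adjoin k H = ⊤ := by
    refine eq_top_iff.mpr fun p _ ↦ ?_
    have hC (r : MvPolynomial (Fin d) k) : C r ∈ Algebra.adjoin k H := by
      have hr : r ∈ Algebra.adjoin k (Set.range (MvPolynomial.X : Fin d → _)) := by
        rw [MvPolynomial.adjoin_range_X]; trivial
      exact Algebra.adjoin_mono (by rintro _ ⟨_, ⟨i, rfl⟩, rfl⟩; exact .inr ⟨i, rfl⟩)
        ((AlgHom.map_adjoin (CAlgHom : _ →ₐ[k] (MvPolynomial (Fin d) k)[X]) _).le ⟨r, hr, rfl⟩)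
    induction p using Polynomial.induction_on' with
    | add p q hp hq => exact add_mem (hp trivial) (hq trivial)
    | monomial n r =>
      rw [← C_mul_X_pow_eq_monomial]
      exact mul_mem (hC r) (pow_mem (Algebra.subset_adjoin (.inl rfl)) n)
  have hclose (V : ValuationSubring k) (a : Fin d → k) (ha : ∀ i, V.valuation (a i) < 1) (y : k)
      (hy : V.valuation (y - ε P.x) < 1) : IsCloseTo V H (B 0 (ε P.x)) (B a y) := by
    rintro _ (rfl | ⟨i, rfl⟩)
    · simpa [B]
    · simpa [B, hb] using ha i
  choose p n hp using P.exists_mul_aeval_x_g_pow_eq_aeval_x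
  have h1 := (Filter.eventually_all_finite hG).mpr fun f (_ : f ∈ G) ↦
    (eventually_valuation_sub_lt_one hH (B 0 (ε P.x)) (p f)).and
    ((eventually_valuation_sub_lt_one hH (B 0 (ε P.x)) (P.g ^ n f)).and
      (eventually_mem_largeValuationSubrings (ε f)))
  have hg0 : B 0 (ε P.x) P.g ≠ 0 := by
    rw [hB]
    exact (P.hasMap.2.map ε).ne_zero
  filter_upwards [h1, eventually_valuation_sub_lt_one hH (B 0 (ε P.x)) P.f,
    eventually_valuation_apply_eq_one hH (B 0 (ε P.x)) hg0] with V h1 hf hg a ha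
  obtain ⟨η, hη, hη'⟩ := exists_root_valuation_sub_lt_one V (P.monic_f.map (b a).toRingHom)
    (y := ε P.x) (by
      have := hf _ (hclose V a ha (ε P.x) (by simp))
      rw [hB, P.hasMap.1, map_zero, sub_zero] at this
      rw [Polynomial.eval_map]
      exact this)
  have hc := hclose V a ha η (by rwa [Valuation.map_sub_swap])
  have hgη := hg _ hc
  let : Algebra (MvPolynomial (Fin d) k) k := (b a).toRingHom.toAlgebra
  have : IsScalarTower k (MvPolynomial (Fin d) k) k := .of_algebraMap_eq' (b a).comp_algebraMap.symm
  have hBη (p : (MvPolynomial (Fin d) k)[X]) : aeval η p = B a η p := rfl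
  have hmap : P.HasMap η := by
    refine ⟨?_, ?_⟩
    · rw [hBη, ← hη, Polynomial.eval_map]
      rfl
    · rw [hBη]
      refine IsUnit.mk0 _ fun h ↦ ?_
      rw [h, map_zero] at hgη
      exact zero_ne_one hgη
  let χ' : D →ₐ[(MvPolynomial (Fin d) k)] k := (P.lift η hmap).comp P.equivRing.toAlgHom
  have hχ'x : χ' P.x = η := by simp [χ']
  have hχ' (p : (MvPolynomial (Fin d) k)[X]) : χ' (aeval P.x p) = B a η p := by
    rw [← aeval_algHom_apply, hχ'x, hBη]
  refine ⟨χ'.restrictScalars k, fun i ↦ ?_, fun f hf ↦ ?_⟩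
  · rw [apply_coordinate', AlgHom.restrictScalars_apply, χ'.commutes]
    change b a (.X i) - _ = _
    rw [hb, add_sub_cancel_left]
  · obtain ⟨hp1, hp2, hp3⟩ := h1 f hf
    specialize hp1 _ hc
    specialize hp2 _ hc
    rw [← hχ', hB, ← hp, map_mul, map_mul, map_pow, map_pow, hχ', ← hB] at hp1
    rw [map_pow, map_pow] at hp2
    rw [AlgHom.restrictScalars_apply]
    have : V.valuation ((χ' f - ε f) * B a η P.g ^ n f) < 1 := by
      rw [show (χ' f - ε f) * B a η P.g ^ n f = χ' f * B a η P.g ^ n f - ε f * B 0 (ε P.x) P.g ^ n f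
        - ε f * (B a η P.g ^ n f - B 0 (ε P.x) P.g ^ n f) by ring]
      refine Valuation.map_sub_lt _ hp1 ?_
      rw [map_mul]
      exact mul_lt_one_of_nonneg_of_lt_one_right hp3 zero_le hp2
    rwa [map_mul, map_pow, hgη, one_pow, mul_one] at this

end EtaleCoordinates

section GroupLawNearOne

/-- In terms of affine charts, a morphism is locally given by fractions. -/
lemma exists_chart_fractions {Y : Scheme} {S E : Type} [CommRing S] [CommRing E]
    (ψ : Spec (CommRingCat.of S) ⟶ Y) (j : Spec (CommRingCat.of E) ⟶ Y) [IsOpenImmersion j]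
    (x : PrimeSpectrum S) (hx : ψ x ∈ Set.range j) :
    ∃ s ∉ x.asIdeal, ∃ (n : E → S) (N : E → ℕ), ∀ (K : Type) [Field K] (χ : S →+* K), χ s ≠ 0 →
      ∃ τ : E →+* K, specMap χ ≫ ψ = specMap τ ≫ j ∧ ∀ f, τ f * χ s ^ N f = χ (n f) := by
  obtain ⟨s, hs, ρ, hρ⟩ := exists_localizationAway_factors ψ j x hx
  have h (f : E) : ∃ n : S, ∃ N : ℕ,
      ρ f * algebraMap S (Localization.Away s) (s ^ N) = algebraMap S _ n := by
    obtain ⟨⟨n, ⟨_, N, rfl⟩⟩, h⟩ := IsLocalization.surj (Submonoid.powers s) (ρ f)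
    exact ⟨n, N, h⟩
  choose n N h using h
  refine ⟨s, hs, n, N, fun K _ χ hχ ↦ ?_⟩
  let χ' : Localization.Away s →+* K := IsLocalization.Away.lift s (IsUnit.mk0 _ hχ)
  have hχ' : χ'.comp (algebraMap S _) = χ := IsLocalization.Away.lift_comp s (IsUnit.mk0 _ hχ)
  refine ⟨χ'.comp ρ, ?_, fun f ↦ ?_⟩
  · rw [specMap_comp χ' ρ, Category.assoc, ← hρ, ← Category.assoc, ← specMap_comp, hχ']
  · have := congrArg χ' (h f)
    rw [map_mul] at this
    rw [← map_pow, ← hχ']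
    exact this

variable {k : Type} [Field k] {D : Type} [CommRing D] [Algebra k D]

section Algebra

variable (ε : D →ₐ[k] k)

/-- Restriction of functions on the square of a pointed affine scheme to the first axis. -/
noncomputable def restrictFst : D ⊗[k] D →ₐ[k] D :=
  Algebra.TensorProduct.productMap (AlgHom.id k D) ((Algebra.ofId k D).comp ε)

/-- Restriction of functions on the square of a pointed affine scheme to the second axis. -/
noncomputable def restrictSnd : D ⊗[k] D →ₐ[k] D :=
  Algebra.TensorProduct.productMap ((Algebra.ofId k D).comp ε) (AlgHom.id k D)

lemma isCloseTo_productMap {V : ValuationSubring k} {G : Set D} {χ χ' : D →ₐ[k] k}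
    (h : IsCloseTo V G ε χ) (h' : IsCloseTo V G ε χ') :
    IsCloseTo V ((Algebra.TensorProduct.includeLeft : D →ₐ[k] D ⊗[k] D) '' G ∪
      (Algebra.TensorProduct.includeRight : D →ₐ[k] D ⊗[k] D) '' G)
      (Algebra.TensorProduct.productMap ε ε) (Algebra.TensorProduct.productMap χ χ') := by
  rintro _ (⟨g, hg, rfl⟩ | ⟨g, hg, rfl⟩)
  · simpa using h g hg
  · simpa using h' g hg

lemma eventually_valuation_productMap_le {G : Set D} (hG : Algebra.adjoin k G = ⊤)
    {ι : Type} (x : ι → D) {t : D} (ht : ε t ≠ 0)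
    (hx : ∀ f, ε f = 0 → t * f ∈ Ideal.span (Set.range x)) (z : D ⊗[k] D) :
    ∀ᶠ V in largeValuationSubrings k, ∀ χ χ' : D →ₐ[k] k, IsCloseTo V G ε χ → IsCloseTo V G ε χ' →
      ∀ c c' : V.ValueGroup, (∀ i, V.valuation (χ (x i)) ≤ c) →
        (∀ i, V.valuation (χ' (x i)) ≤ c') →
        V.valuation (Algebra.TensorProduct.productMap χ χ' z - χ (restrictFst ε z) -
          χ' (restrictSnd ε z) + ε (restrictFst ε z)) ≤ c * c' := by
  induction z using TensorProduct.induction_on with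
  | zero => exact .of_forall fun V χ χ' _ _ c c' _ _ ↦ by simp
  | add z w hz hw =>
    filter_upwards [hz, hw] with V hz hw χ χ' h h' c c' hc hc'
    refine le_trans (le_of_eq ?_)
      (Valuation.map_add_le _ (hz χ χ' h h' c c' hc hc') (hw χ χ' h h' c c' hc hc'))
    simp only [map_add]
    ring_nf
  | tmul a b =>
    filter_upwards [eventually_valuation_apply_le hG ε x ht
        (hx (a - algebraMap k D (ε a)) (by simp)),
      eventually_valuation_apply_le hG ε x ht
        (hx (b - algebraMap k D (ε b)) (by simp))] with V ha hb χ χ' h h' c c' hc hc'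
    refine le_trans (le_of_eq ?_) (mul_le_mul' (ha χ h c hc) (hb χ' h' c' hc'))
    rw [← map_mul]
    congr 1
    simp [restrictFst, restrictSnd, Algebra.ofId_apply]
    ring

end Algebra

variable {Ab : AbelianVarietyOver (Spec (CommRingCat.of k))}
  {j : Spec (CommRingCat.of D) ⟶ Ab.Ab}
  (hj : j ≫ Ab.s = specMap (algebraMap k D)) {ε : D →ₐ[k] k}
  (hε : specMap ε.toRingHom ≫ j = Ab.one)

include hj hε in
lemma specMap_ofId_comp : specMap ((Algebra.ofId k D).comp ε).toRingHom ≫ j = j ≫ Ab.s ≫ Ab.one := by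
  rw [← hε, ← Category.assoc, ← Category.assoc, hj, ← specMap_comp]
  rfl

include hε in
lemma specMap_restrictSnd_comp :
    specMap (restrictSnd ε).toRingHom ≫ mulChart hj hj = j := by
  rw [restrictSnd, specMap_comp_mulChart]
  have h : specMap (AlgHom.id k D).toRingHom ≫ j = j := by
    rw [show specMap (AlgHom.id k D).toRingHom = 𝟙 _ from Spec.map_id _, Category.id_comp]
  simp only [specMap_ofId_comp hj hε, h, AbelianVarietyOver.mulMap]
  exact Ab.one_mul' _ j _

include hε in
lemma specMap_restrictFst_comp :
    specMap (restrictFst ε).toRingHom ≫ mulChart hj hj = j := by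
  rw [restrictFst, specMap_comp_mulChart]
  have h : specMap (AlgHom.id k D).toRingHom ≫ j = j := by
    rw [show specMap (AlgHom.id k D).toRingHom = 𝟙 _ from Spec.map_id _, Category.id_comp]
  simp only [specMap_ofId_comp hj hε, h, AbelianVarietyOver.mulMap]
  rw [Ab.mul_comm']
  exact Ab.one_mul' _ j _

include hj hε in
/-- Near the origin of an abelian variety, the group law is addition up to terms of higher order. -/
lemma eventually_exists_add_eq [IsDomain D] [IsOpenImmersion j] {G : Set D}
    (hG : Algebra.adjoin k G = ⊤) {ι : Type} (x : ι → D) {t : D} (ht : ε t ≠ 0)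
    (hx : ∀ f, ε f = 0 → t * f ∈ Ideal.span (Set.range x))
    {F : Set D} (hF : F.Finite) (hεF : ∀ f ∈ F, ε f = 0) :
    ∀ᶠ V in largeValuationSubrings k, ∀ χ χ' : D →ₐ[k] k, IsCloseTo V G ε χ → IsCloseTo V G ε χ' →
      ∀ P P' : Ab.Point, P.1 = specMap χ.toRingHom ≫ j → P'.1 = specMap χ'.toRingHom ≫ j →
      ∃ χ'' : D →ₐ[k] k, (Ab.add P P').1 = specMap χ''.toRingHom ≫ j ∧
        ∀ c c' : V.ValueGroup, (∀ i, V.valuation (χ (x i)) ≤ c) →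
        (∀ i, V.valuation (χ' (x i)) ≤ c') →
        ∀ f ∈ F, V.valuation (χ'' f - χ f - χ' f) ≤ c * c' := by
  let εε : D ⊗[k] D →ₐ[k] k := Algebra.TensorProduct.productMap ε ε
  have hεε : εε = ε.comp (restrictFst ε) := by
    ext a <;> simp [εε, restrictFst]
  have hεε' : εε = ε.comp (restrictSnd ε) := by
    ext a <;> simp [εε, restrictSnd]
  let e : Spec (CommRingCat.of k) := IsLocalRing.closedPoint k
  have hone : specMap εε.toRingHom ≫ mulChart hj hj = specMap ε.toRingHom ≫ j := by
    rw [hεε, show (ε.comp (restrictFst ε)).toRingHom = ε.toRingHom.comp (restrictFst ε).toRingHom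
      from rfl, specMap_comp, Category.assoc, specMap_restrictFst_comp hj hε]
  obtain ⟨s, hs, n, N, hτ⟩ := exists_chart_fractions (mulChart hj hj) j
    (specMap εε.toRingHom e) (by
      rw [← Scheme.Hom.comp_apply, hone, Scheme.Hom.comp_apply]
      exact Set.mem_range_self _)
  have hs : εε s ≠ 0 := fun h ↦ hs (by
    change εε s ∈ IsLocalRing.maximalIdeal k
    rw [h]
    exact zero_mem _)
  have key (p : D ⊗[k] D →ₐ[k] D) (hp : specMap p.toRingHom ≫ mulChart hj hj = j)
      (hp' : εε = ε.comp p) (f : D) : p (n f) = f * p s ^ N f := by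
    let q : D ⊗[k] D →+* FractionRing D := (algebraMap D (FractionRing D)).comp p.toRingHom
    have hps : p s ≠ 0 := fun h ↦ hs (by rw [hp', AlgHom.comp_apply, h, map_zero])
    obtain ⟨τ, hτ, hτ'⟩ := hτ (FractionRing D) q (by simpa [q] using hps)
    rw [specMap_comp, Category.assoc, hp, cancel_mono] at hτ
    rw [← specMap_injective hτ] at hτ'
    have := hτ' f
    simp only [q, RingHom.comp_apply] at this
    rw [← map_pow, ← map_mul] at this
    exact (IsFractionRing.injective D (FractionRing D) this).symm
  have h1 := (Filter.eventually_all_finite hF).mpr fun f (_ : f ∈ F) ↦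
    eventually_valuation_productMap_le ε hG x ht hx (n f - s ^ N f * (f ⊗ₜ 1 + 1 ⊗ₜ f))
  filter_upwards [h1, eventually_valuation_apply_eq_one (adjoin_tensorProduct hG hG) εε hs]
    with V h1 h2 χ χ' h h' P P' hP hP'
  have hχs := h2 _ (isCloseTo_productMap ε h h')
  obtain ⟨τ, hτ, hτ'⟩ := hτ k (Algebra.TensorProduct.productMap χ χ').toRingHom fun h0 ↦ by
    change Algebra.TensorProduct.productMap χ χ' s = 0 at h0
    rw [h0, map_zero] at hχs
    exact zero_ne_one hχs
  have hadd : (Ab.add P P').1 = specMap τ ≫ j := by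
    rw [← hτ, specMap_comp_mulChart]
    simp only [AbelianVarietyOver.add, hP, hP']
  obtain ⟨χ'', rfl⟩ := exists_algHom_of_comp_eq_id hj (hadd ▸ (Ab.add P P').2)
  refine ⟨χ'', hadd, fun c c' hc hc' f hf ↦ ?_⟩
  have h3 := h1 f hf χ χ' h h' c c' hc hc'
  have hr1 : restrictFst ε (n f - s ^ N f * (f ⊗ₜ 1 + 1 ⊗ₜ f)) = 0 := by
    rw [map_sub, key _ (specMap_restrictFst_comp hj hε) hεε]
    simp [restrictFst, hεF f hf, mul_comm]
  have hr2 : restrictSnd ε (n f - s ^ N f * (f ⊗ₜ 1 + 1 ⊗ₜ f)) = 0 := by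
    rw [map_sub, key _ (specMap_restrictSnd_comp hj hε) hεε']
    simp [restrictSnd, hεF f hf, mul_comm]
  rw [hr1, hr2, map_zero, map_zero, map_zero, sub_zero, sub_zero, add_zero] at h3
  have h4 : Algebra.TensorProduct.productMap χ χ' (n f - s ^ N f * (f ⊗ₜ 1 + 1 ⊗ₜ f)) =
      (χ'' f - χ f - χ' f) * Algebra.TensorProduct.productMap χ χ' s ^ N f := by
    have := hτ' f
    rw [map_sub, ← show _ = Algebra.TensorProduct.productMap χ χ' (n f) from this]
    simp
    ring
  rwa [h4, map_mul, map_pow, hχs, one_pow, mul_one] at h3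

end GroupLawNearOne

section LeadingForm

open MvPolynomial

lemma MvPolynomial.IsHomogeneous.eval₂_mul {σ R A : Type*} [CommSemiring R] [CommSemiring A]
    {F : MvPolynomial σ R} {r : ℕ} (hF : F.IsHomogeneous r) (f : R →+* A) (c : A) (y : σ → A) :
    F.eval₂ f (fun i ↦ c * y i) = c ^ r * F.eval₂ f y := by
  rw [MvPolynomial.eval₂_eq, MvPolynomial.eval₂_eq, Finset.mul_sum]
  refine Finset.sum_congr rfl fun m hm ↦ ?_
  simp_rw [mul_pow, Finset.prod_mul_distrib, Finset.prod_pow_eq_pow_sum]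
  rw [← hF.degree_eq_sum_deg_support hm]
  ring

variable {k : Type} [Field k] {D : Type} [CommRing D] [Algebra k D]

lemma adjoin_mvPolynomial {σ : Type} {G : Set D} (hG : Algebra.adjoin k G = ⊤) :
    Algebra.adjoin k (C '' G ∪ Set.range X : Set (MvPolynomial σ D)) = ⊤ := by
  have hC (r : D) : (C r : MvPolynomial σ D) ∈
      Algebra.adjoin k (C '' G ∪ Set.range X : Set (MvPolynomial σ D)) := by
    have hr : r ∈ Algebra.adjoin k G := hG ▸ trivial
    exact Algebra.adjoin_mono Set.subset_union_left ((AlgHom.map_adjoin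
      (IsScalarTower.toAlgHom k D (MvPolynomial σ D)) G).le ⟨r, hr, rfl⟩)
  refine eq_top_iff.mpr fun p _ ↦ ?_
  induction p using MvPolynomial.induction_on with
  | C r => exact hC r
  | add p q hp hq => exact add_mem (hp trivial) (hq trivial)
  | mul_X p i hp => exact mul_mem (hp trivial) (Algebra.subset_adjoin (.inr ⟨i, rfl⟩))

/-- A function vanishing at a point has a non-zero leading form in suitable coordinates. -/
lemma exists_leadingForm [IsNoetherianRing D] [IsDomain D] (ε : D →ₐ[k] k) {ι : Type} (x : ι → D)
    (hεx : ∀ i, ε (x i) = 0) {t : D} (ht : ε t ≠ 0)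
    (hx : ∀ f, ε f = 0 → t * f ∈ Ideal.span (Set.range x)) {g : D} (hg : g ≠ 0) (hεg : ε g = 0) :
    ∃ r ≠ 0, ∃ (m : ℕ) (F : MvPolynomial ι D), F.IsHomogeneous r ∧ F.eval x = t ^ m * g ∧
      F.map ε.toRingHom ≠ 0 := by
  classical
  let I : Ideal D := RingHom.ker ε
  let J : Ideal D := Ideal.span (Set.range x)
  have hJI : J ≤ I := Ideal.span_le.mpr (by rintro _ ⟨i, rfl⟩; exact hεx i)
  have hex : ∃ r, ¬ ∃ m, t ^ m * g ∈ J ^ r := by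
    by_contra! h
    refine hg ?_
    have h0 : g ∈ ⨅ r, I ^ r := by
      refine Ideal.mem_iInf.mpr fun r ↦ ?_
      obtain ⟨m, hm⟩ := h r
      have hc : IsCoprime (Ideal.span {t ^ m}) (I ^ r) := by
        refine .pow_right (Ideal.isCoprime_iff_exists.mpr
          ⟨t ^ m * algebraMap k D (ε (t ^ m))⁻¹, Ideal.mul_mem_right _ _ (Ideal.mem_span_singleton_self _),
          1 - t ^ m * algebraMap k D (ε (t ^ m))⁻¹, ?_, by ring⟩)
        have : ε (t ^ m) ≠ 0 := by rw [map_pow]; exact pow_ne_zero m ht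
        simp only [I, RingHom.mem_ker, map_sub, map_one, map_mul, AlgHom.commutes]
        simp [ht]
      obtain ⟨a, ha, b, hb, hab⟩ := Ideal.isCoprime_iff_exists.mp hc
      obtain ⟨a, rfl⟩ := Ideal.mem_span_singleton.mp ha
      rw [← one_mul g, ← hab, add_mul, mul_right_comm]
      exact add_mem (Ideal.mul_mem_right _ _ (Ideal.pow_right_mono hJI r hm)) (Ideal.mul_mem_right _ _ hb)
    rwa [Ideal.iInf_pow_eq_bot_of_isDomain I (RingHom.ker_ne_top ε.toRingHom)] at h0
  obtain ⟨r, hr⟩ : ∃ r, Nat.find hex = r + 1 :=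
    Nat.exists_eq_succ_of_ne_zero fun h ↦ (h ▸ Nat.find_spec hex) ⟨0, by simp⟩
  have hr' : ¬ ∃ m, t ^ m * g ∈ J ^ (r + 1) := hr ▸ Nat.find_spec hex
  obtain ⟨m, hm⟩ : ∃ m, t ^ m * g ∈ J ^ r := by
    by_contra h
    exact absurd (Nat.find_min' hex h) (by omega)
  obtain ⟨F, hF, hFx⟩ := (Ideal.mem_span_pow_iff_exists_isHomogeneous x _).mp hm
  refine ⟨r, ?_, m, F, hF, hFx, fun h ↦ hr' ⟨m + 1, ?_⟩⟩
  · rintro rfl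
    exact hr' ⟨1, by simpa using hx g hεg⟩
  · rw [pow_succ' t, mul_assoc, ← hFx, MvPolynomial.eval_eq, Finset.mul_sum]
    refine sum_mem fun e he ↦ ?_
    rw [← mul_assoc, pow_succ']
    refine Ideal.mul_mem_mul (hx _ ?_) ?_
    · have := congrArg (coeff e) h
      rwa [coeff_map] at this
    · have h1 := Ideal.prod_mem_prod fun i (_ : i ∈ e.support) ↦
        Ideal.pow_mem_pow (Ideal.subset_span ⟨i, rfl⟩ : x i ∈ J) (e i)
      rwa [Finset.prod_pow_eq_pow_sum, ← hF.degree_eq_sum_deg_support he] at h1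

variable [CharZero k]

lemma exists_nat_eval_ne_zero {σ : Type} [Finite σ] {F : MvPolynomial σ k} (hF : F ≠ 0) :
    ∃ u : σ → ℕ, F.eval (fun i ↦ (u i : k)) ≠ 0 := by
  by_contra! h
  refine hF (MvPolynomial.funext_set (fun _ ↦ Set.range ((↑) : ℕ → k))
    (fun _ ↦ Set.infinite_range_of_injective Nat.cast_injective) fun y hy ↦ ?_)
  choose u hu using fun i ↦ hy i trivial
  rw [map_zero, ← h u]
  congr
  exact (_root_.funext hu).symm

/-- The value of a form at points close to `p ^ n u`, if its reduction does not vanish at `u`. -/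
lemma eventually_valuation_apply_eval_eq {G : Set D} (hG : Algebra.adjoin k G = ⊤) (ε : D →ₐ[k] k)
    {ι : Type} (x : ι → D) {F : MvPolynomial ι D} {r : ℕ} (hF : F.IsHomogeneous r) (u : ι → ℕ)
    (hu : (F.map ε.toRingHom).eval (fun i ↦ (u i : k)) ≠ 0) :
    ∀ᶠ V in largeValuationSubrings k, ∀ χ : D →ₐ[k] k, IsCloseTo V G ε χ →
      ∀ p : ℕ, p ≠ 0 → V.valuation p < 1 → ∀ n : ℕ,
      (∀ i, V.valuation (χ (x i) - p ^ n * u i) ≤ V.valuation p ^ (n + 1)) →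
      V.valuation (χ (F.eval x)) = V.valuation p ^ (n * r) := by
  have hu' : aevalTower ε (fun i ↦ (u i : k)) F ≠ 0 := by
    rw [MvPolynomial.eval_map] at hu
    exact hu
  filter_upwards [eventually_valuation_apply_eq_one (adjoin_mvPolynomial hG) _ hu']
    with V hV χ hχ p hp hp1 n hn
  have hpn : (p : k) ^ n ≠ 0 := pow_ne_zero n (Nat.cast_ne_zero.mpr hp)
  let y (i : ι) : k := χ (x i) / p ^ n
  have hy (i) : χ (x i) = p ^ n * y i := by simp only [y]; field_simp
  have h1 : χ (F.eval x) = (p ^ n) ^ r * aevalTower χ y F := by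
    change _ = _ * F.eval₂ χ.toRingHom y
    rw [← hF.eval₂_mul, ← AlgHom.coe_toRingHom, ← eval₂_id, MvPolynomial.hom_eval₂]
    simp only [← hy]
    rfl
  rw [h1, map_mul, hV (aevalTower χ y), mul_one, map_pow, map_pow, pow_mul]
  rintro _ (⟨g, hg, rfl⟩ | ⟨i, rfl⟩)
  · simpa using hχ g hg
  · have h2 : (p : k) ^ n * (y i - u i) = χ (x i) - p ^ n * u i := by rw [hy]; ring
    have h3 := hn i
    rw [← h2, map_mul, map_pow, pow_succ] at h3
    rw [aevalTower_X, aevalTower_X]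
    refine lt_of_le_of_lt ((mul_le_mul_iff_right₀ ?_).mp h3) hp1
    rw [← map_pow]
    exact zero_lt_iff.mpr ((Valuation.ne_zero_iff _).mpr hpn)

end LeadingForm

section Iterate

variable {k : Type} [Field k]

/-- Iterating multiplication by `p` in a group law which is addition up to terms of
higher order. -/
lemma exists_valuation_sub_le_of_add {A ι : Type} (add : A → A → A) (V : ValuationSubring k)
    (Rel : A → (ι → k) → Prop)
    (hadd : ∀ P P' a a', Rel P a → Rel P' a' → ∃ a'', Rel (add P P') a'' ∧ ∀ c < 1,
      (∀ i, V.valuation (a i) ≤ c) → (∀ i, V.valuation (a' i) ≤ c) →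
        ∀ i, V.valuation (a'' i - a i - a' i) ≤ c * c)
    {p : ℕ} (hp : p ≠ 0) (hp1 : V.valuation (p : k) < 1) (u : ι → ℕ) {P : A}
    (hP : Rel P fun i ↦ p ^ 2 * u i) (n : ℕ) :
    ∃ Q a, Rel Q a ∧
      ∀ i, V.valuation (a i - p ^ (n + 2) * u i) ≤ V.valuation (p : k) ^ (n + 2 + 1) := by
  have hnat (m : ℕ) : V.valuation (m : k) ≤ 1 := (V.valuation_le_one_iff _).mpr (natCast_mem V m)
  induction n with
  | zero => exact ⟨P, _, hP, fun i ↦ by simp⟩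
  | succ n ih =>
    obtain ⟨Q, a, hQ, ha⟩ := ih
    set c := V.valuation (p : k)
    have ha' (i) : V.valuation (a i) ≤ c ^ (n + 2) := by
      rw [← sub_add_cancel (a i) (p ^ (n + 2) * u i)]
      refine Valuation.map_add_le _ ((ha i).trans (pow_le_pow_of_le_one zero_le hp1.le (by omega))) ?_
      rw [map_mul, map_pow]
      exact mul_le_of_le_one_right zero_le (hnat _)
    have hc : c ^ (n + 2) < 1 := pow_lt_one₀ zero_le hp1 (by omega)
    have hm (m : ℕ) : ∃ Q' a', Rel Q' a' ∧
        ∀ i, V.valuation (a' i - (m + 1 : ℕ) * a i) ≤ c ^ (n + 2) * c ^ (n + 2) := by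
      induction m with
      | zero => exact ⟨Q, a, hQ, fun i ↦ by simp⟩
      | succ m ih =>
        obtain ⟨Q', a', hQ', ha''⟩ := ih
        obtain ⟨b, hb, hb'⟩ := hadd Q Q' a a' hQ hQ'
        refine ⟨_, b, hb, fun i ↦ ?_⟩
        have h := hb' _ hc ha' (fun i ↦ ?_) i
        · rw [show b i - (m + 1 + 1 : ℕ) * a i = (b i - a i - a' i) + (a' i - (m + 1 : ℕ) * a i) by
            push_cast; ring]
          exact Valuation.map_add_le _ h (ha'' i)
        · rw [← sub_add_cancel (a' i) ((m + 1 : ℕ) * a i)]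
          refine Valuation.map_add_le _ ((ha'' i).trans (mul_le_of_le_one_right zero_le hc.le)) ?_
          rw [map_mul]
          exact (mul_le_of_le_one_left zero_le (hnat _)).trans (ha' i)
    obtain ⟨Q', a', hQ', ha''⟩ := hm (p - 1)
    rw [Nat.sub_add_cancel (Nat.one_le_iff_ne_zero.mpr hp)] at ha''
    refine ⟨Q', a', hQ', fun i ↦ ?_⟩
    rw [show a' i - p ^ (n + 1 + 2) * u i = (a' i - p * a i) + p * (a i - p ^ (n + 2) * u i) by ring]
    refine Valuation.map_add_le _ ((ha'' i).trans ?_) ?_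
    · rw [← pow_add]
      exact pow_le_pow_of_le_one zero_le hp1.le (by omega)
    · rw [map_mul, pow_succ' c (n + 1 + 2)]
      exact mul_le_mul_right (ha i) _

end Iterate

section ResidueCharacteristic

instance Int.isJacobsonRing : IsJacobsonRing ℤ := by
  refine isJacobsonRing_iff_prime_eq.mpr fun P hP ↦ ?_
  by_cases h : P = ⊥
  · refine h ▸ eq_bot_iff.mpr fun x hx ↦ ?_
    have h1 := Int.isUnit_iff.mp (Ideal.mem_jacobson_bot.mp hx x)
    rw [Ideal.mem_bot]
    rcases h1 with h1 | h1
    · simpa using h1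
    · nlinarith [mul_self_nonneg x]
  · have := hP.isMaximal h
    exact Ideal.jacobson_eq_self_of_isMaximal

variable {k : Type} [Field k]

/-- There are arbitrarily large valuation rings with positive residue characteristic. -/
lemma exists_natCast_valuation_lt_one {q : ValuationSubring k → Prop}
    (hq : ∀ᶠ V in largeValuationSubrings k, q V) :
    ∃ V, q V ∧ ∃ p : ℕ, p ≠ 0 ∧ V.valuation (p : k) < 1 := by
  obtain ⟨C, hC, hCq⟩ := exists_finite_of_eventually_largeValuationSubrings hq
  have := finiteType_closure hC
  obtain ⟨m, hm⟩ := Ideal.exists_maximal (Subring.closure C)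
  let _ : Field (Subring.closure C ⧸ m) := Ideal.Quotient.field m
  have : Algebra.FiniteType ℤ (Subring.closure C ⧸ m) :=
    Algebra.FiniteType.of_surjective (Ideal.Quotient.mkₐ ℤ m) Ideal.Quotient.mk_surjective
  have : Module.Finite ℤ (Subring.closure C ⧸ m) := finite_of_finite_type_of_isJacobsonRing _ _
  have hinj : ¬ Function.Injective (algebraMap ℤ (Subring.closure C ⧸ m)) := fun h ↦
    Int.not_isField (isField_of_isIntegral_of_isField h (Field.toIsField _))
  rw [injective_iff_map_eq_zero] at hinj
  push Not at hinj
  obtain ⟨n, hn, hn0⟩ := hinj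
  obtain ⟨V, hV, hmV⟩ := Ideal.image_subset_nonunits_valuationSubring m hm.ne_top
  refine ⟨V, hCq V (Subring.subset_closure.trans hV), n.natAbs, Int.natAbs_ne_zero.mpr hn0, ?_⟩
  have hnm : (n : Subring.closure C) ∈ m := by
    rw [← Ideal.Quotient.eq_zero_iff_mem, ← hn]
    simp
  have h1 : V.valuation (n : k) < 1 := by
    have := hmV ⟨_, hnm, rfl⟩
    simpa using (ValuationSubring.mem_nonunits_iff V).mp this
  rcases Int.natAbs_eq n with h | h <;> rw [h] at h1 <;> simpa using h1

end ResidueCharacteristic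

section Chart

variable {k : Type} [Field k]

lemma exists_etale_chart {Ab : AbelianVarietyOver (Spec (CommRingCat.of k))} {X : Scheme}
    (φ : Ab.Ab ⟶ X) :
    ∃ (d : ℕ) (D : Type) (_ : CommRing D) (_ : Algebra k D) (_ : Algebra (MvPolynomial (Fin d) k) D)
      (_ : IsScalarTower k (MvPolynomial (Fin d) k) D)
      (_ : Algebra.IsStandardEtale (MvPolynomial (Fin d) k) D)
      (j : Spec (CommRingCat.of D) ⟶ Ab.Ab) (_ : IsOpenImmersion j) (ε : D →ₐ[k] k)
      (E : Type) (_ : CommRing E) (v : Spec (CommRingCat.of E) ⟶ X) (_ : IsOpenImmersion v)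
      (θ : E →+* D), j ≫ Ab.s = specMap (algebraMap k D) ∧ specMap ε.toRingHom ≫ j = Ab.one ∧
        j ≫ φ = specMap θ ≫ v := by
  have := Ab.proper
  have := Ab.smooth
  obtain ⟨ι, _, D₀, _, _, j₀, _, -, -, -, hj₀, hjs₀⟩ := exists_finite_affine_cover Ab.s
  let o : Spec (CommRingCat.of k) := IsLocalRing.closedPoint k
  obtain ⟨i, hi⟩ := hj₀ (Ab.one o)
  have ho (y : Spec (CommRingCat.of k)) : y = o := Subsingleton.elim (α := PrimeSpectrum k) _ _
  have hr : Set.range Ab.one ⊆ Set.range (j₀ i) := by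
    rintro _ ⟨y, rfl⟩
    rwa [ho y]
  obtain ⟨ε₀, hε₀⟩ := exists_eq_specMap (IsOpenImmersion.lift (j₀ i) Ab.one hr)
  have hε₀' : specMap ε₀ ≫ j₀ i = Ab.one := by rw [← hε₀, IsOpenImmersion.lift_fac]
  obtain ⟨E, _, v, _, hv₀⟩ : ∃ (E : Type) (_ : CommRing E) (v : Spec (CommRingCat.of E) ⟶ X)
      (_ : IsOpenImmersion v), φ (Ab.one o) ∈ Set.range v :=
    ⟨X.affineOpenCover.X _, inferInstance, X.affineOpenCover.f _, X.affineOpenCover.map_prop _,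
      X.affineOpenCover.covers _⟩
  have hv : (j₀ i ≫ φ) (specMap ε₀ o) ∈ Set.range v := by
    have : (j₀ i ≫ φ) (specMap ε₀ o) = φ (Ab.one o) := by
      rw [← hε₀']
      simp
    rwa [this]
  obtain ⟨s, hs, ρ, hρ⟩ := exists_localizationAway_factors (j₀ i ≫ φ) v _ hv
  have hs' : IsUnit (ε₀ s) := by
    refine IsUnit.mk0 _ fun h ↦ hs ?_
    change ε₀ s ∈ IsLocalRing.maximalIdeal k
    rw [h]
    exact zero_mem _
  let D₁ := Localization.Away s
  let ε₁ : D₁ →+* k := IsLocalization.Away.lift s hs'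
  have hε₁ : ε₁.comp (algebraMap _ D₁) = ε₀ := IsLocalization.Away.lift_comp s hs'
  have : IsOpenImmersion (specMap (algebraMap (D₀ i) D₁)) :=
    Scheme.isOpenImmersion_SpecMap_localizationAway (R := CommRingCat.of (D₀ i)) s
  let j₁ : Spec (CommRingCat.of D₁) ⟶ Ab.Ab := specMap (algebraMap (D₀ i) D₁) ≫ j₀ i
  have hj₁ : j₁ ≫ Ab.s = specMap (algebraMap k D₁) := by
    rw [Category.assoc, hjs₀, ← specMap_comp]
  have hsm : Algebra.Smooth k D₁ := by
    have h1 : Smooth (specMap (algebraMap k D₁)) := by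
      have : Smooth Ab.s := Ab.smooth
      rw [← hj₁]; infer_instance
    have h2 : (algebraMap k D₁).Smooth := (HasRingHomProperty.Spec_iff (P := @Smooth)).mp h1
    exact (RingHom.smooth_algebraMap).mp h2
  have : (RingHom.ker ε₁).IsPrime := RingHom.ker_isPrime ε₁
  obtain ⟨f, hf, d, _, _, _⟩ :=
    Algebra.IsSmoothAt.exists_isStandardEtale_mvPolynomial (R := k) (p := RingHom.ker ε₁)
  have hf' : IsUnit (ε₁ f) := IsUnit.mk0 _ hf
  let D := Localization.Away f
  let ε : D →+* k := IsLocalization.Away.lift f hf'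
  have hε : ε.comp (algebraMap _ D) = ε₁ := IsLocalization.Away.lift_comp f hf'
  have : IsOpenImmersion (specMap (algebraMap D₁ D)) :=
    Scheme.isOpenImmersion_SpecMap_localizationAway (R := CommRingCat.of D₁) f
  let j : Spec (CommRingCat.of D) ⟶ Ab.Ab := specMap (algebraMap D₁ D) ≫ j₁
  have hj : j ≫ Ab.s = specMap (algebraMap k D) := by
    rw [Category.assoc, hj₁, ← specMap_comp]
  have hεj : specMap ε ≫ j = Ab.one := by
    rw [← Category.assoc, ← specMap_comp, hε, ← Category.assoc, ← specMap_comp, hε₁, hε₀']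
  obtain ⟨ε', hε'⟩ := exists_algHom_of_comp_eq_id hj (χ := ε) (hεj ▸ Ab.one_over)
  refine ⟨d, D, inferInstance, inferInstance, inferInstance, inferInstance, inferInstance, j,
    inferInstance, ε', E, inferInstance, v, inferInstance, (algebraMap D₁ D).comp ρ, hj, hε' ▸ hεj, ?_⟩
  rw [specMap_comp, Category.assoc, Category.assoc, Category.assoc, ← hρ]

end Chart

section Main

variable {k : Type} [Field k]

/-- In the closure of a suitable point under addition there are points near the origin where a given
function takes infinitely many values. -/
lemma exists_infinite_image_of_ne_zero [IsAlgClosed k] [CharZero k]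
    {Ab : AbelianVarietyOver (Spec (CommRingCat.of k))} {d : ℕ} {D : Type} [CommRing D] [IsDomain D]
    [Algebra k D] [Algebra (MvPolynomial (Fin d) k) D] [IsScalarTower k (MvPolynomial (Fin d) k) D]
    [Algebra.IsStandardEtale (MvPolynomial (Fin d) k) D] {j : Spec (CommRingCat.of D) ⟶ Ab.Ab}
    [IsOpenImmersion j] (hj : j ≫ Ab.s = specMap (algebraMap k D)) {ε : D →ₐ[k] k}
    (hε : specMap ε.toRingHom ≫ j = Ab.one) {g : D} (hg : g ≠ 0) (hεg : ε g = 0) :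
    ∃ (P : Ab.Point) (χ : ℕ → D →ₐ[k] k) (Q : ℕ → Ab.Point),
      (∀ n, (Q n).1 = specMap (χ n).toRingHom ≫ j) ∧ Function.Injective (fun n ↦ χ n g) ∧
      ∀ (n : ℕ) (q : Ab.Point → Prop), q P → (∀ Q Q', q Q → q Q' → q (Ab.add Q Q')) → q (Q n) := by
  have hft : Algebra.FiniteType k D :=
    Algebra.FiniteType.trans (S := MvPolynomial (Fin d) k) inferInstance inferInstance
  have : IsNoetherianRing D := Algebra.FiniteType.isNoetherianRing k D
  obtain ⟨G₀, hG₀⟩ := hft.out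
  let G : Set D := G₀
  have hG : Algebra.adjoin k G = ⊤ := hG₀
  have hGfin : G.Finite := G₀.finite_toSet
  let x : Fin d → D := coordinate ε
  obtain ⟨t, ht, hx⟩ := exists_mul_mem_span_coordinate (d := d) ε
  obtain ⟨r, hr, m, F, hF, hFg, hF0⟩ :=
    exists_leadingForm ε x (apply_coordinate ε) ht hx hg hεg
  obtain ⟨u, hu⟩ := exists_nat_eval_ne_zero hF0
  obtain ⟨V, ⟨hV1, hV2, hV3, hV4, hV5⟩, p, hp, hp1⟩ := exists_natCast_valuation_lt_one
    ((eventually_exists_coordinate_eq (d := d) ε hGfin).and <|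
      (eventually_exists_add_eq hj hε hG x ht hx
        (F := Set.range x ∪ (fun g ↦ g - algebraMap k D (ε g)) '' G)
        ((Set.finite_range x).union (hGfin.image _)) (by
          rintro _ (⟨i, rfl⟩ | ⟨g, -, rfl⟩)
          · exact apply_coordinate ε i
          · simp)).and <|
      (eventually_valuation_apply_eval_eq hG ε x hF u hu).and <|
      (eventually_valuation_apply_eq_one hG ε ht).and <|
      Filter.eventually_all.mpr fun i ↦ eventually_valuation_sub_lt_one hG ε (x i))
  have hnat (n : ℕ) : V.valuation (n : k) ≤ 1 := (V.valuation_le_one_iff _).mpr (natCast_mem V n)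
  have hp0 : V.valuation (p : k) ≠ 0 := by simpa using hp
  obtain ⟨χ₀, hχ₀x, hχ₀⟩ := hV1 (fun i ↦ p ^ 2 * u i) fun i ↦ by
    rw [map_mul, map_pow]
    exact mul_lt_one_of_lt_of_le (pow_lt_one₀ zero_le hp1 two_ne_zero) (hnat _)
  let P : Ab.Point := ⟨specMap χ₀.toRingHom ≫ j, by
    rw [specMap_comp_chart hj]
    exact Spec.map_id _⟩
  let Rel (Q : Ab.Point) (a : Fin d → k) : Prop :=
    (∀ q : Ab.Point → Prop, q P → (∀ Q Q', q Q → q Q' → q (Ab.add Q Q')) → q Q) ∧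
      ∃ χ : D →ₐ[k] k, Q.1 = specMap χ.toRingHom ≫ j ∧ IsCloseTo V G ε χ ∧ ∀ i, χ (x i) = a i
  have hlt (χ : D →ₐ[k] k) (hχ : IsCloseTo V G ε χ) : ∃ c < 1, ∀ i, V.valuation (χ (x i)) ≤ c := by
    refine ⟨Finset.univ.sup fun i ↦ V.valuation (χ (x i)), (Finset.sup_lt_iff ?_).mpr fun i _ ↦ ?_,
      fun i ↦ Finset.le_sup (f := fun i ↦ V.valuation (χ (x i))) (Finset.mem_univ i)⟩
    · exact hp1.bot_lt
    · simpa [x, apply_coordinate] using hV5 i χ hχ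
  have hrec (n : ℕ) := exists_valuation_sub_le_of_add Ab.add V Rel (by
    rintro Q Q' a a' ⟨hQ, χ, hQχ, hχ, hχa⟩ ⟨hQ', χ', hQχ', hχ', hχa'⟩
    obtain ⟨χ'', hadd, h⟩ := hV2 χ χ' hχ hχ' Q Q' hQχ hQχ'
    refine ⟨fun i ↦ χ'' (x i), ⟨fun q hq hqq ↦ hqq _ _ (hQ q hq hqq) (hQ' q hq hqq), χ'', hadd, ?_,
      fun i ↦ rfl⟩, fun c hc ha ha' i ↦ ?_⟩
    · obtain ⟨c, hc, hχc⟩ := hlt χ hχ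
      obtain ⟨c', hc', hχc'⟩ := hlt χ' hχ'
      intro g hg
      have h1 := (h c c' hχc hχc' _ (.inr ⟨g, hg, rfl⟩)).trans_lt
        (mul_lt_one_of_lt_of_le hc hc'.le)
      have h2 : χ'' g - ε g = (χ'' (g - algebraMap k D (ε g)) - χ (g - algebraMap k D (ε g)) -
          χ' (g - algebraMap k D (ε g))) + ((χ g - ε g) + (χ' g - ε g)) := by
        simp only [map_sub, AlgHom.commutes, Algebra.algebraMap_self, RingHom.id_apply]
        ring
      rw [h2]
      exact Valuation.map_add_lt _ h1 (Valuation.map_add_lt _ (hχ g hg) (hχ' g hg))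
    · have := h c c (by simpa only [hχa] using ha) (by simpa only [hχa'] using ha') (x i)
        (.inl ⟨i, rfl⟩)
      simpa only [hχa, hχa'] using this) hp hp1 u (P := P) ⟨fun q hq _ ↦ hq, χ₀, rfl, hχ₀, hχ₀x⟩ n
  choose Q a hQ ha using hrec
  choose hQΓ χ hQχ hχ hχa using hQ
  refine ⟨P, χ, Q, hQχ, ?_, hQΓ⟩
  have hval (n : ℕ) : V.valuation (χ n g) = V.valuation (p : k) ^ ((n + 2) * r) := by
    have h1 := hV3 (χ n) (hχ n) p hp hp1 (n + 2) (by simpa only [hχa] using ha n)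
    rw [hFg, map_mul, map_pow, map_mul, map_pow, hV4 (χ n) (hχ n), one_pow, one_mul] at h1
    exact h1
  intro n n' h
  have h1 : V.valuation (χ n g) = V.valuation (χ n' g) := congrArg _ h
  rw [hval, hval] at h1
  have h2 := (pow_right_strictAnti₀ (zero_lt_iff.mpr hp0) hp1).injective h1
  have h3 := Nat.eq_of_mul_eq_mul_right (Nat.pos_of_ne_zero hr) h2
  omega

/-- A morphism from an abelian variety to a variety with finitely many integral points is
constant. -/
theorem exists_eq_of_abelianVariety [IsAlgClosed k] [CharZero k] {X : Scheme}
    {sX : X ⟶ Spec (CommRingCat.of k)} [IsSeparated sX] (hX : HasFinitenessOfIntegralPoints sX)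
    (Ab : AbelianVarietyOver (Spec (CommRingCat.of k))) (φ : Ab.Ab ⟶ X) (hφ : φ ≫ sX = Ab.s) :
    ∃ x : Spec (CommRingCat.of k) ⟶ X, φ = Ab.s ≫ x := by
  obtain ⟨d, D, _, _, _, _, _, j, _, ε, E, _, v, _, θ, hj, hε, hθ⟩ := exists_etale_chart φ
  have := Ab.integral
  have hne : Nonempty (Spec (CommRingCat.of D)) := ⟨specMap ε.toRingHom (IsLocalRing.closedPoint k)⟩
  have : IsIntegral (Spec (CommRingCat.of D)) := isIntegral_of_isOpenImmersion j
  have : IsDomain D := (affine_isIntegral_iff (CommRingCat.of D)).mp this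
  by_cases h : ∀ e, θ e = algebraMap k D (ε (θ e))
  · refine ⟨Ab.one ≫ φ, ?_⟩
    have : IsDominant j := ⟨(j.isOpenEmbedding.isOpen_range.dense (Set.range_nonempty j))⟩
    refine ext_of_isDominant_of_isSeparated sX ?_ j ?_
    · rw [Category.assoc, Category.assoc, hφ, Ab.one_over, Category.comp_id]
    · rw [← hε, Category.assoc, hθ, ← Category.assoc _ _ v, ← specMap_comp, ← Category.assoc, hj,
        ← Category.assoc, ← specMap_comp]
      congr 2
      exact RingHom.ext h
  · push Not at h
    obtain ⟨e, he⟩ := h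
    obtain ⟨P, χ, Q, hQ, hinj, hΓ⟩ := exists_infinite_image_of_ne_zero (d := d) hj hε
      (sub_ne_zero.mpr he) (by simp)
    have hfin := finite_of_add_closed Ab hX φ hφ P (Set.range Q) (by
      rintro q hq hqq _ ⟨n, rfl⟩
      exact hΓ n q hq hqq)
    rw [← Set.range_comp] at hfin
    refine absurd hfin (Set.infinite_range_of_injective fun n n' h ↦ hinj ?_)
    simp only [Function.comp_apply, hQ, Category.assoc, hθ] at h
    rw [← Category.assoc, ← Category.assoc, ← specMap_comp, ← specMap_comp, cancel_mono] at h
    have := DFunLike.congr_fun (specMap_injective h) e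
    simpa using this

end Main

end TensorProducts

/- STATEMENT 19. `X` is a variety over an algebraically closed field `k` of
characteristic zero which is arithmetically hyperbolic over `k`: there is a ℤ-finitely
generated subring `A ⊆ k` and a finite type separated model `𝒳 / A` of `X` (i.e. the
base change of `𝒳` along `Spec k → Spec A` is isomorphic to `X` over `Spec k`) such that
for every ℤ-finitely generated subring `A' ⊆ k` containing `A` the set `𝒳(A')` of
`A'`-points of `𝒳` is finite.  Conclusion (grouplessness for `𝔾_m` and abelian
varieties): every `k`-morphism `𝔾_{m,k} = Spec k[t,t⁻¹] → X` is constant (factors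
through `Spec k`), and every `k`-morphism from an abelian variety over `k` to `X` is
constant. -/
theorem stmt_19 (k : Type) [Field k] [IsAlgClosed k] [CharZero k]
    (X : Scheme) (sX : X ⟶ Spec (CommRingCat.of k))
    [LocallyOfFiniteType sX] [QuasiCompact sX] [IsSeparated sX]
    (harith : ∃ (A : Subring k) (_ : Algebra.FiniteType ℤ A)
      (𝒳 : Scheme) (s𝒳 : 𝒳 ⟶ Spec (CommRingCat.of A))
      (_ : LocallyOfFiniteType s𝒳) (_ : QuasiCompact s𝒳) (_ : IsSeparated s𝒳)
      (iso : pullback s𝒳 (Spec.map (CommRingCat.ofHom A.subtype)) ≅ X),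
      iso.hom ≫ sX = pullback.snd s𝒳 (Spec.map (CommRingCat.ofHom A.subtype)) ∧
      ∀ (A' : Subring k) (hAA' : A ≤ A'), Algebra.FiniteType ℤ A' →
        {q : Spec (CommRingCat.of A') ⟶ 𝒳 |
          q ≫ s𝒳 = Spec.map (CommRingCat.ofHom (Subring.inclusion hAA'))}.Finite) :
    (∀ φ : Spec (CommRingCat.of (LaurentPolynomial k)) ⟶ X,
      φ ≫ sX = Spec.map (CommRingCat.ofHom (algebraMap k (LaurentPolynomial k))) →
      ∃ x : Spec (CommRingCat.of k) ⟶ X,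
        φ = Spec.map (CommRingCat.ofHom (algebraMap k (LaurentPolynomial k))) ≫ x) ∧
    (∀ (Ab : AbelianVarietyOver (Spec (CommRingCat.of k))) (φ : Ab.Ab ⟶ X),
      φ ≫ sX = Ab.s → ∃ x : Spec (CommRingCat.of k) ⟶ X, φ = Ab.s ≫ x) := by
  have hX := hasFinitenessOfIntegralPoints X sX harith
  exact ⟨fun φ hφ ↦ exists_eq_of_multiplicative hX φ hφ,
    fun Ab φ hφ ↦ exists_eq_of_abelianVariety hX Ab φ hφ⟩
end
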